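/- arXiv:1812.03036 — 5 statements merged into one kernel-verified Lean document; each statement's English description precedes it below -/
import Mathlib

section
/- Let c > 1 be a real number that is not an integer, and let m ≥ 2 be an integer. Then the sequence x_n = ⌊n^c⌋ mod m is not normal in base m; more precisely, there exists a positive integer k and a block B ∈ {0,1,…,m−1}^k that does not occur as a contiguous subword of (x_n)_{n≥0}. -/
open Filter Topology

theorem ps_weights (r : ℕ) : ∃ w : ℕ → ℤ, (∀ i, 0 ≤ (-1) ^ (r + i) * w i) ∧
    (∀ l < r, ∑ i ∈ Finset.range (r + 1), w i * (2 ^ l) ^ i = 0) ∧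
    0 < ∑ i ∈ Finset.range (r + 1), w i * (2 ^ r) ^ i := by
  let P : ℕ → Polynomial ℤ := fun r => ∏ l ∈ Finset.range r, (Polynomial.X - Polynomial.C (2 ^ l))
  have hdeg : ∀ r, (P r).natDegree = r := by
    intro r
    have := Polynomial.natDegree_finsetProd_X_sub_C_eq_card (Finset.range r) (fun l : ℕ => (2:ℤ)^l)
    simpa [P] using this
  have hev : ∀ x : ℤ, ∑ i ∈ Finset.range (r + 1), (P r).coeff i * x ^ i = ∏ l ∈ Finset.range r, (x - 2 ^ l) := by
    intro x
    rw [← Polynomial.eval_eq_sum_range' (by rw [hdeg]; omega)]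
    simp [P, Polynomial.eval_prod]
  refine ⟨fun i => (P r).coeff i, ?_, ?_, ?_⟩
  · have hs : ∀ r i, 0 ≤ (-1) ^ (r + i) * (P r).coeff i := by
      intro r
      induction r with
      | zero =>
        intro i
        simp only [P, Finset.range_zero, Finset.prod_empty, Polynomial.coeff_one]
        split_ifs with h
        · simp [h]
        · simp
      | succ r ih =>
        intro i
        have hP : P (r + 1) = P r * (Polynomial.X - Polynomial.C (2 ^ r)) := by
          simp only [P, Finset.prod_range_succ]
        rw [hP]
        cases i with
        | zero =>
          have h0 := ih 0
          rw [mul_sub, Polynomial.coeff_sub, Polynomial.coeff_mul_C, Polynomial.coeff_mul_X_zero]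
          have : (-1 : ℤ) ^ (r + 1 + 0) * (0 - (P r).coeff 0 * 2 ^ r)
            = ((-1) ^ (r + 0) * (P r).coeff 0) * 2 ^ r := by ring
          rw [this]; positivity
        | succ i =>
          have h0 := ih (i + 1)
          have h1 := ih i
          rw [Polynomial.coeff_mul_X_sub_C]
          have : (-1 : ℤ) ^ (r + 1 + (i + 1)) * ((P r).coeff i - (P r).coeff (i + 1) * 2 ^ r)
            = ((-1) ^ (r + i) * (P r).coeff i) + ((-1) ^ (r + (i+1)) * (P r).coeff (i+1)) * 2 ^ r := by ring
          rw [this]; positivity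
    exact hs r
  · intro l hl
    simp only [hev]
    exact Finset.prod_eq_zero (Finset.mem_range.2 hl) (by simp)
  · simp only [hev]
    apply Finset.prod_pos
    intro l hl
    have : (2:ℤ) ^ l < 2 ^ r := pow_lt_pow_right₀ (by norm_num) (Finset.mem_range.1 hl)
    linarith

section

attribute [local instance] Ultrafilter.add Ultrafilter.addSemigroup

theorem ps_recur {G : Type*} [AddCommGroup G] [TopologicalSpace G] [IsTopologicalAddGroup G]
    [CompactSpace G] [T2Space G] : ∃ p : Ultrafilter ℕ+, ∀ (l : ℕ), 1 ≤ l → ∀ g : G,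
      Tendsto (fun h : ℕ+ => ((h : ℕ) ^ l) • g) p (𝓝 0) := by
  obtain ⟨p, hp⟩ := exists_idempotent_of_compact_t2_of_continuous_add_left
    (@Ultrafilter.continuous_add_left ℕ+ _)
  refine ⟨p, ?_⟩
  intro l
  induction l using Nat.strong_induction_on with
  | _ l ih =>
    intro hl g
    obtain ⟨L, hL⟩ : ∃ L, Tendsto (fun h : ℕ+ => ((h : ℕ) ^ l) • g) p (𝓝 L) :=
      ⟨_, (p.map (fun h : ℕ+ => ((h : ℕ) ^ l) • g)).le_nhds_lim⟩
    have h1 : ∀ a : ℕ+, Tendsto (fun b : ℕ+ => (((a + b : ℕ+) : ℕ) ^ l) • g) p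
        (𝓝 (((a : ℕ) ^ l) • g + L)) := by
      intro a
      obtain ⟨k, rfl⟩ : ∃ k, l = k + 1 := ⟨l - 1, by omega⟩
      have e : ∀ b : ℕ+, (((a + b : ℕ+) : ℕ) ^ (k + 1)) • g =
          (((a : ℕ) ^ (k + 1)) • g + ((b : ℕ) ^ (k + 1)) • g) + ∑ j ∈ Finset.range k,
            ((b : ℕ) ^ (j + 1)) • (((a : ℕ) ^ (k - j) * (k + 1).choose (j + 1)) • g) := by
        intro b
        have : ((a + b : ℕ+) : ℕ) ^ (k + 1) = (a : ℕ) ^ (k + 1) + (b : ℕ) ^ (k + 1) +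
           ∑ j ∈ Finset.range k, (b : ℕ) ^ (j + 1) * ((a : ℕ) ^ (k - j) * (k + 1).choose (j + 1)) := by
          rw [PNat.add_coe, add_comm (a : ℕ), add_pow, Finset.sum_range_succ, Finset.sum_range_succ']
          simp only [Nat.choose_self, Nat.sub_self, pow_zero, Nat.choose_zero_right]
          have : ∀ j, k + 1 - (j + 1) = k - j := by intro j; omega
          simp only [this, mul_assoc]
          simp
          ring
        rw [this, add_smul, add_smul, Finset.sum_smul]
        simp only [mul_smul]
      simp only [e]
      have hs : Tendsto (fun b : ℕ+ => ∑ j ∈ Finset.range k,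
            ((b : ℕ) ^ (j + 1)) • (((a : ℕ) ^ (k - j) * (k + 1).choose (j + 1)) • g)) p
            (𝓝 (∑ j ∈ Finset.range k, 0)) := by
        apply tendsto_finsetSum
        intro j hj
        exact ih (j + 1) (by have := Finset.mem_range.1 hj; omega) (by omega) _
      simpa using (hL.const_add (((a : ℕ) ^ (k + 1)) • g)).add hs
    have h2 : Tendsto (fun a : ℕ+ => ((a : ℕ) ^ l) • g + L) p (𝓝 L) := by
      rw [(closed_nhds_basis L).tendsto_right_iff]
      rintro U ⟨hU, hUc⟩
      have h3 : ∀ᶠ h : ℕ+ in (p : Filter ℕ+), ((h : ℕ) ^ l) • g ∈ U := hL hU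
      rw [← hp, Ultrafilter.eventually_add] at h3
      filter_upwards [h3] with a ha
      exact hUc.mem_of_tendsto (h1 a) ha
    have h3 : L + L = L := tendsto_nhds_unique (hL.add_const L) h2
    have : L = 0 := by simpa using h3
    rwa [this] at hL

end

theorem ps_taylor (c : ℝ) (r : ℕ) (x : ℕ) :
    Tendsto (fun n : ℕ => (((n + x : ℕ) : ℝ) ^ c - ∑ l ∈ Finset.range r,
      (x : ℝ) ^ l * (Ring.choose c l * (n : ℝ) ^ (c - l))) * (n : ℝ) ^ (r - c)) atTop
      (𝓝 (Ring.choose c r * x ^ r)) := by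
  have hO := (Real.one_add_rpow_hasFPowerSeriesAt_zero (a := c)).isBigO_sub_partialSum_pow (r + 1)
  have hu : Tendsto (fun n : ℕ => (x : ℝ) / n) atTop (𝓝 0) := tendsto_const_div_atTop_nhds_zero_nat _
  have hO2 := hO.comp_tendsto hu
  have hO3 := hO2.mul (Asymptotics.isBigO_refl (fun n : ℕ => (n : ℝ) ^ r) atTop)
  have h0 : Tendsto (fun n : ℕ => ‖(x : ℝ) / n‖ ^ (r + 1) * (n : ℝ) ^ r) atTop (𝓝 0) := by
    have : Tendsto (fun n : ℕ => (x : ℝ) ^ r * ((x : ℝ) / n)) atTop (𝓝 ((x : ℝ) ^ r * 0)) := hu.const_mul _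
    rw [mul_zero] at this
    refine this.congr' ?_
    filter_upwards [eventually_gt_atTop 0] with n hn
    have : (0 : ℝ) < n := by exact_mod_cast hn
    rw [Real.norm_of_nonneg (by positivity), div_pow]
    field_simp
    ring
  have h1 := hO3.trans_tendsto h0
  have h2 := h1.add_const (Ring.choose c r * (x : ℝ) ^ r)
  rw [zero_add] at h2
  refine h2.congr' ?_
  filter_upwards [eventually_gt_atTop 0] with n hn
  have hn : (0 : ℝ) < n := by exact_mod_cast hn
  have e1 : ((n + x : ℕ) : ℝ) ^ c = (n : ℝ) ^ c * (1 + (x : ℝ) / n) ^ c := by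
    rw [← Real.mul_rpow hn.le (by positivity)]
    congr 1
    push_cast
    field_simp
  have e2 : (n : ℝ) ^ ((r : ℝ) - c) = (n : ℝ) ^ r / (n : ℝ) ^ c := by
    rw [Real.rpow_sub hn, Real.rpow_natCast]
  have e3 : ∀ l : ℕ, (n : ℝ) ^ (c - l) = (n : ℝ) ^ c / (n : ℝ) ^ l := by
    intro l
    rw [Real.rpow_sub hn, Real.rpow_natCast]
  have hc : (0 : ℝ) < (n : ℝ) ^ c := Real.rpow_pos_of_pos hn c
  simp only [Function.comp, zero_add, FormalMultilinearSeries.partialSum, binomialSeries_apply,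
    List.ofFn_const, List.prod_replicate, smul_eq_mul, e1, e2, e3, Finset.sum_range_succ]
  have e4 : ∑ l ∈ Finset.range r, (x : ℝ) ^ l * (Ring.choose c l * ((n : ℝ) ^ c / (n : ℝ) ^ l))
      = (n : ℝ) ^ c * ∑ l ∈ Finset.range r, Ring.choose c l * ((x : ℝ) / n) ^ l := by
    rw [Finset.mul_sum]
    refine Finset.sum_congr rfl fun l _ => ?_
    rw [div_pow]; ring
  rw [e4, div_pow]
  field_simp
  ring

theorem ps_choose_pos (c : ℝ) (r : ℕ) (h : (r : ℝ) < c + 1) : 0 < Ring.choose c r := by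
  rw [Ring.choose_eq_smul]
  have : 0 < (descPochhammer ℤ r).smeval c := by
    induction r with
    | zero => simp
    | succ r ih =>
      push_cast at h
      rw [descPochhammer_succ_right, Polynomial.smeval_mul]
      apply mul_pos (ih (by linarith))
      simp [Polynomial.smeval_sub, Polynomial.smeval_natCast]
      linarith
  have := Nat.factorial_pos r
  rw [smul_eq_mul]
  positivity

theorem ps_rem (c : ℝ) (r : ℕ) (hr : c < r) (x : ℕ) :
    Tendsto (fun n : ℕ => ((n + x : ℕ) : ℝ) ^ c - ∑ l ∈ Finset.range r,
      (x : ℝ) ^ l * (Ring.choose c l * (n : ℝ) ^ (c - l))) atTop (𝓝 0) := by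
  have h0 : Tendsto (fun n : ℕ => (n : ℝ) ^ (-(r - c))) atTop (𝓝 0) :=
    (tendsto_rpow_neg_atTop (by linarith)).comp tendsto_natCast_atTop_atTop
  have := (ps_taylor c r x).mul h0
  rw [mul_zero] at this
  refine this.congr' ?_
  filter_upwards [eventually_gt_atTop 0] with n hn
  have hn : (0 : ℝ) < n := by exact_mod_cast hn
  rw [mul_assoc, ← Real.rpow_add hn]
  simp

theorem ps_T (c : ℝ) (r : ℕ) (hr : c < r) (hr' : (r : ℝ) < c + 1) (w : ℕ → ℤ)
    (hw : ∀ l < r, ∑ i ∈ Finset.range (r + 1), w i * (2 ^ l) ^ i = 0)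
    (hw' : 0 < ∑ i ∈ Finset.range (r + 1), w i * (2 ^ r) ^ i) (h : ℕ) (hh : 0 < h) :
    ∀ᶠ n : ℕ in atTop, 0 < ∑ i ∈ Finset.range (r + 1), (w i : ℝ) * ((n + h * 2 ^ i : ℕ) : ℝ) ^ c ∧
      ∑ i ∈ Finset.range (r + 1), (w i : ℝ) * ((n + h * 2 ^ i : ℕ) : ℝ) ^ c < 1 / 2 := by
  have hpow : ∀ l : ℕ, ∑ i ∈ Finset.range (r + 1), (w i : ℝ) * (((h * 2 ^ i : ℕ) : ℝ)) ^ l =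
      h ^ l * ((∑ i ∈ Finset.range (r + 1), w i * (2 ^ l) ^ i : ℤ) : ℝ) := by
    intro l
    push_cast
    rw [Finset.mul_sum]
    refine Finset.sum_congr rfl fun i _ => ?_
    rw [mul_pow, ← pow_mul, ← pow_mul, mul_comm i l]; ring
  have hsum : ∀ n : ℕ, ∑ i ∈ Finset.range (r + 1), (w i : ℝ) * (((n + h * 2 ^ i : ℕ) : ℝ) ^ c -
      ∑ l ∈ Finset.range r, ((h * 2 ^ i : ℕ) : ℝ) ^ l * (Ring.choose c l * (n : ℝ) ^ (c - l))) =
      ∑ i ∈ Finset.range (r + 1), (w i : ℝ) * ((n + h * 2 ^ i : ℕ) : ℝ) ^ c := by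
    intro n
    simp only [mul_sub, Finset.sum_sub_distrib, Finset.mul_sum]
    rw [Finset.sum_comm (s := Finset.range (r + 1)) (t := Finset.range r)]
    rw [sub_eq_self]
    apply Finset.sum_eq_zero
    intro l hl
    simp only [← mul_assoc]
    rw [← Finset.sum_mul, ← Finset.sum_mul, hpow, hw l (Finset.mem_range.1 hl)]
    simp
  have t1 := tendsto_finsetSum (Finset.range (r + 1)) (fun i _ =>
    (ps_taylor c r (h * 2 ^ i)).const_mul (w i : ℝ))
  have t2 := tendsto_finsetSum (Finset.range (r + 1)) (fun i _ =>
    (ps_rem c r hr (h * 2 ^ i)).const_mul (w i : ℝ))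
  simp only [hsum] at t2
  have e0 : ∀ n : ℕ, ∑ i ∈ Finset.range (r + 1), (w i : ℝ) * ((((n + h * 2 ^ i : ℕ) : ℝ) ^ c -
      ∑ l ∈ Finset.range r, ((h * 2 ^ i : ℕ) : ℝ) ^ l * (Ring.choose c l * (n : ℝ) ^ (c - l))) *
      (n : ℝ) ^ (r - c)) = (∑ i ∈ Finset.range (r + 1), (w i : ℝ) *
        ((n + h * 2 ^ i : ℕ) : ℝ) ^ c) * (n : ℝ) ^ (r - c) := by
    intro n
    rw [← hsum n, Finset.sum_mul]
    exact Finset.sum_congr rfl fun i _ => by ring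
  simp only [e0] at t1
  simp only [← mul_assoc] at t1
  have hpos : 0 < ∑ i ∈ Finset.range (r + 1), (w i : ℝ) * Ring.choose c r * ((h * 2 ^ i : ℕ) : ℝ) ^ r := by
    have : ∑ i ∈ Finset.range (r + 1), (w i : ℝ) * Ring.choose c r * ((h * 2 ^ i : ℕ) : ℝ) ^ r =
      Ring.choose c r * ∑ i ∈ Finset.range (r + 1), (w i : ℝ) * (((h * 2 ^ i : ℕ) : ℝ)) ^ r := by
      rw [Finset.mul_sum]
      exact Finset.sum_congr rfl fun i _ => by ring
    rw [this, hpow]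
    have h1 := ps_choose_pos c r hr'
    have h2 : (0 : ℝ) < ((∑ i ∈ Finset.range (r + 1), w i * (2 ^ r) ^ i : ℤ) : ℝ) := by exact_mod_cast hw'
    positivity
  have e1 := t1.eventually (lt_mem_nhds hpos)
  have e2 := t2.eventually_lt_const (u := (1 / 2 : ℝ)) (by simp)
  filter_upwards [e1, e2] with n h1 h2
  exact ⟨pos_of_mul_pos_left h1 (by positivity), h2⟩

/-- Combinatorial core: signs. -/
theorem ps_core (r : ℕ) (m : ℤ) (hm : 2 ≤ m) (w : ℕ → ℤ) (hs : ∀ i, 0 ≤ (-1) ^ (r + i) * w i)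
    (hw0 : ∑ i ∈ Finset.range (r + 1), w i = 0) (ε θ : ℝ) (hε : ε ≤ 1 / 8)
    (hεw : (∑ i ∈ Finset.range (r + 1), |(w i : ℝ)|) * ε ≤ 1 / 2)
    (g : ℕ → ℝ) (z : ℕ → ℤ) (hz : ∀ i < r + 2, |g i - θ - z i * m| < ε)
    (hT : ∀ s < 2, 0 < ∑ i ∈ Finset.range (r + 1), (w i : ℝ) * g (i + s) ∧
      ∑ i ∈ Finset.range (r + 1), (w i : ℝ) * g (i + s) < 1 / 2)
    (b : ℕ) (hb : ∀ i < r + 2, ⌊g i⌋ % m = (((b + i) % 2 : ℕ) : ℤ)) : False := by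
  set M := round θ with hM
  have hθ : |θ - M| ≤ 1 / 2 := abs_sub_round θ
  set y : ℕ → ℝ := fun i => g i - z i * m - M with hy
  have hyb : ∀ i < r + 2, |y i| < 1 := by
    intro i hi
    have h1 := abs_lt.1 (hz i hi)
    have h2 := abs_le.1 hθ
    rw [abs_lt]
    constructor <;> simp only [hy] <;> linarith [h1.1, h1.2, h2.1, h2.2]
  have hfl : ∀ i, ⌊g i⌋ = ⌊y i⌋ + M + z i * m := by
    intro i
    have : g i = y i + ((M + z i * m : ℤ) : ℝ) := by simp only [hy]; push_cast; ring
    rw [this, Int.floor_add_intCast]; ring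
  have hfy : ∀ i < r + 2, (0 ≤ y i ∧ (((b + i) % 2 : ℕ) : ℤ) = M % m) ∨
      (y i < 0 ∧ (((b + i) % 2 : ℕ) : ℤ) = (M - 1) % m) := by
    intro i hi
    have h1 := abs_lt.1 (hyb i hi)
    have h2 := hb i hi
    rw [hfl, Int.add_mul_emod_self_right] at h2
    rcases le_or_gt 0 (y i) with h | h
    · left
      have : ⌊y i⌋ = 0 := Int.floor_eq_iff.2 ⟨by simpa using h, by simpa using h1.2⟩
      rw [this, zero_add] at h2
      exact ⟨h, h2.symm⟩
    · right
      have : ⌊y i⌋ = -1 := Int.floor_eq_iff.2 ⟨by simpa using h1.1.le, by simpa using h⟩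
      rw [this] at h2
      refine ⟨h, ?_⟩
      rw [← h2]; congr 1; ring
  have halt : ∀ i j, i < r + 2 → j < r + 2 → (i % 2 ≠ j % 2) → y j < 0 → 0 ≤ y i := by
    intro i j hi hj hij h
    by_contra! hcon
    rcases hfy i hi with h1 | h1
    · linarith [h1.1]
    rcases hfy j hj with h2 | h2
    · linarith [h2.1]
    have := h1.2.trans h2.2.symm
    omega
  have halt' : ∀ i j, i < r + 2 → j < r + 2 → (i % 2 ≠ j % 2) → 0 ≤ y j → y i < 0 := by
    intro i j hi hj hij h
    by_contra! hcon
    rcases hfy i hi with h1 | h1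
    swap
    · linarith [h1.1]
    rcases hfy j hj with h2 | h2
    swap
    · linarith [h2.1]
    have := h1.2.trans h2.2.symm
    omega
  obtain ⟨s, hs2, hneg⟩ : ∃ s < 2, y (r + s) < 0 := by
    rcases lt_or_ge (y (r + 0)) 0 with h | h
    · exact ⟨0, by norm_num, h⟩
    · exact ⟨1, by norm_num, halt' _ _ (by omega) (by omega) (by omega) h⟩
  have hw0' : ∑ i ∈ Finset.range (r + 1), (w i : ℝ) = 0 := by exact_mod_cast hw0
  set Z : ℤ := ∑ i ∈ Finset.range (r + 1), w i * z (i + s) with hZ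
  obtain ⟨hT1, hT2⟩ := hT s hs2
  have hdec : ∑ i ∈ Finset.range (r + 1), (w i : ℝ) * g (i + s) =
      ∑ i ∈ Finset.range (r + 1), (w i : ℝ) * (g (i + s) - θ - z (i + s) * m) + Z * m := by
    rw [hZ]
    push_cast
    rw [Finset.sum_mul, ← Finset.sum_add_distrib, ← sub_eq_zero, ← Finset.sum_sub_distrib]
    rw [← mul_zero θ, ← hw0', Finset.mul_sum]
    exact Finset.sum_congr rfl fun i _ => by ring
  have hdec2 : ∑ i ∈ Finset.range (r + 1), (w i : ℝ) * g (i + s) =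
      ∑ i ∈ Finset.range (r + 1), (w i : ℝ) * y (i + s) + Z * m := by
    rw [hZ]
    push_cast
    rw [Finset.sum_mul, ← Finset.sum_add_distrib, ← sub_eq_zero, ← Finset.sum_sub_distrib]
    rw [← mul_zero (M : ℝ), ← hw0', Finset.mul_sum]
    exact Finset.sum_congr rfl fun i _ => by simp only [hy]; ring
  have hE : |∑ i ∈ Finset.range (r + 1), (w i : ℝ) * (g (i + s) - θ - z (i + s) * m)| ≤ 1 / 2 := by
    refine le_trans (Finset.abs_sum_le_sum_abs _ _) (le_trans ?_ hεw)
    rw [Finset.sum_mul]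
    refine Finset.sum_le_sum fun i hi => ?_
    rw [abs_mul]
    have := Finset.mem_range.1 hi
    exact mul_le_mul_of_nonneg_left (hz _ (by omega)).le (abs_nonneg _)
  have hE' := abs_le.1 hE
  have hZ0 : Z = 0 := by
    have h1 : (-1 : ℝ) < Z * m := by linarith
    have h2 : (Z * m : ℝ) < 1 := by linarith
    have h1' : -1 < Z * m := by exact_mod_cast h1
    have h2' : Z * m < 1 := by exact_mod_cast h2
    have h3 : Z * m = 0 := by omega
    rcases mul_eq_zero.1 h3 with h | h
    · exact h
    · omega
  rw [hZ0] at hdec2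
  have hle : ∑ i ∈ Finset.range (r + 1), (w i : ℝ) * y (i + s) ≤ 0 := by
    apply Finset.sum_nonpos
    intro i hi
    have hi := Finset.mem_range.1 hi
    have hsi := hs i
    rcases Nat.even_or_odd (r + i) with h | h
    · rw [h.neg_one_pow, one_mul] at hsi
      have hw : (0 : ℝ) ≤ w i := by exact_mod_cast hsi
      have hyi : y (i + s) < 0 := by
        have hpar : (i + s) % 2 = (r + s) % 2 := by
          have := Nat.even_iff.1 h; omega
        by_contra! hcon
        rcases hfy (i + s) (by omega) with h1 | h1
        swap
        · linarith [h1.1]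
        rcases hfy (r + s) (by omega) with h2 | h2
        · linarith [h2.1]
        have h3 : (((b + (i + s)) % 2 : ℕ) : ℤ) = (((b + (r + s)) % 2 : ℕ) : ℤ) := by
          congr 1; omega
        have h4 : M % m = (M - 1) % m := by rw [← h1.2, h3, h2.2]
        have h5 := (Int.emod_emod_of_dvd M (dvd_refl m))
        have h6 : m ∣ M - (M - 1) := Int.ModEq.dvd (Eq.symm h4)
        have h7 : m ∣ 1 := by simpa using h6
        have := Int.le_of_dvd one_pos h7
        omega
      exact mul_nonpos_of_nonneg_of_nonpos hw hyi.le
    · rw [h.neg_one_pow] at hsi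
      have hw : (w i : ℝ) ≤ 0 := by
        have : w i ≤ 0 := by linarith
        exact_mod_cast this
      have hpar : (i + s) % 2 ≠ (r + s) % 2 := by
        have := Nat.odd_iff.1 h; omega
      exact mul_nonpos_of_nonpos_of_nonneg hw (halt _ _ (by omega) (by omega) hpar hneg)
  simp at hdec2
  linarith

theorem piatetski_shapiro_mod_m_not_normal (c : ℝ) (hc : 1 < c)
    (hcint : ∀ n : ℤ, c ≠ (n : ℝ)) (m : ℤ) (hm : 2 ≤ m) :
    ∃ k : ℕ, 0 < k ∧ ∃ B : Fin k → ℤ, (∀ i, 0 ≤ B i ∧ B i < m) ∧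
      ∀ n : ℕ, ∃ i : Fin k, ⌊((n + i : ℕ) : ℝ) ^ c⌋ % m ≠ B i := by
  by_contra! hcon
  -- occurrences of arbitrarily long prefixes of the 2-adic parity word, arbitrarily far out
  have hocc : ∀ j : ℕ, ∃ n : ℕ, j ≤ n ∧ ∀ x ≤ j,
      ⌊((n + x : ℕ) : ℝ) ^ c⌋ % m = ((padicValNat 2 x % 2 : ℕ) : ℤ) := by
    intro j
    obtain ⟨n, hn⟩ := hcon (2 * j + 1) (by omega)
      (fun i => ((padicValNat 2 ((i : ℕ) - j) % 2 : ℕ) : ℤ)) (fun i => by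
        constructor
        · positivity
        · have : padicValNat 2 ((i : ℕ) - j) % 2 < 2 := Nat.mod_lt _ (by norm_num)
          omega)
    refine ⟨n + j, by omega, fun x hx => ?_⟩
    have := hn ⟨j + x, by omega⟩
    simp only [Nat.add_sub_cancel_left] at this
    rw [← this, add_assoc]
  choose N hN hocc using hocc
  obtain ⟨d, hd⟩ : ∃ d : ℕ, d = ⌊c⌋₊ := ⟨_, rfl⟩
  have hd1 : (d : ℝ) < c := by
    refine lt_of_le_of_ne (hd ▸ Nat.floor_le (by linarith)) (fun h => hcint d ?_)
    rw [← h]; simp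
  have hd2 : c < ((d + 1 : ℕ) : ℝ) := by
    rw [hd]; push_cast; exact Nat.lt_floor_add_one c
  obtain ⟨w, hws, hwk, hwp⟩ := ps_weights (d + 1)
  have hw0 : ∑ i ∈ Finset.range (d + 1 + 1), w i = 0 := by simpa using hwk 0 (by omega)
  have hmR : (0 : ℝ) < (m : ℝ) := by exact_mod_cast (by omega : 0 < m)
  have : Fact (0 < (m : ℝ)) := ⟨hmR⟩
  obtain ⟨p, hp⟩ := ps_recur (G := AddCircle (m : ℝ))
  let q : Ultrafilter ℕ := hyperfilter ℕ
  have hNq : Tendsto N q atTop :=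
    (tendsto_atTop_mono hN tendsto_id).mono_left Nat.hyperfilter_le_atTop
  have hlim : ∀ l : ℕ, ∃ a : AddCircle (m : ℝ), Tendsto (fun k : ℕ =>
      ((Ring.choose c l * (N k : ℝ) ^ (c - l) : ℝ) : AddCircle (m : ℝ))) q (𝓝 a) := fun l =>
    ⟨_, (q.map (fun k : ℕ =>
      ((Ring.choose c l * (N k : ℝ) ^ (c - l) : ℝ) : AddCircle (m : ℝ)))).le_nhds_lim⟩
  choose a ha using hlim
  have hQ : ∀ x : ℕ, Tendsto (fun k : ℕ => ((((N k + x : ℕ) : ℝ) ^ c : ℝ) : AddCircle (m : ℝ))) q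
      (𝓝 (∑ l ∈ Finset.range (d + 1), (x ^ l) • a l)) := by
    intro x
    have h1 : Tendsto (fun k : ℕ => ∑ l ∈ Finset.range (d + 1), (x ^ l) •
        ((Ring.choose c l * (N k : ℝ) ^ (c - l) : ℝ) : AddCircle (m : ℝ))) q
        (𝓝 (∑ l ∈ Finset.range (d + 1), (x ^ l) • a l)) :=
      tendsto_finsetSum _ fun l _ => (ha l).const_smul (x ^ l)
    have h2 := ((AddCircle.continuous_mk' (m : ℝ)).tendsto 0).comp
      ((ps_rem c (d + 1) hd2 x).comp hNq)
    have h3 := h2.add h1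
    simp only [map_zero, zero_add] at h3
    refine h3.congr fun k => ?_
    have e : ∀ l : ℕ, (x ^ l) • ((Ring.choose c l * (N k : ℝ) ^ (c - l) : ℝ) : AddCircle (m : ℝ)) =
      (((x : ℝ) ^ l * (Ring.choose c l * (N k : ℝ) ^ (c - l)) : ℝ) : AddCircle (m : ℝ)) := by
      intro l
      rw [← AddCircle.coe_nsmul, nsmul_eq_mul]
      push_cast
      rfl
    simp only [e, Function.comp]
    have e2 : ∀ s : Finset ℕ, ∀ f : ℕ → ℝ, ∑ l ∈ s, ((f l : ℝ) : AddCircle (m : ℝ)) =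
      ((∑ l ∈ s, f l : ℝ) : AddCircle (m : ℝ)) := fun s f =>
        (map_sum (QuotientAddGroup.mk' (AddSubgroup.zmultiples (m : ℝ))) f s).symm
    rw [e2]
    change ((_ : ℝ) : AddCircle (m : ℝ)) + _ = _
    rw [← AddCircle.coe_add]
    congr 1
    ring
  set C := ∑ i ∈ Finset.range (d + 1 + 1), |(w i : ℝ)| with hC
  have hC0 : 0 ≤ C := Finset.sum_nonneg fun _ _ => abs_nonneg _
  obtain ⟨ε, hε0, hε1, hε2⟩ : ∃ ε : ℝ, 0 < ε ∧ ε ≤ 1 / 8 ∧ C * ε ≤ 1 / 2 := by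
    refine ⟨1 / (8 * (C + 1)), by positivity, ?_, ?_⟩
    · rw [div_le_div_iff₀ (by positivity) (by positivity)]; linarith
    · rw [mul_one_div, div_le_div_iff₀ (by positivity) (by positivity)]; linarith
  -- recurrence: find `h`
  obtain ⟨h, hh⟩ : ∃ h : ℕ+, ∀ i ∈ Finset.range (d + 1 + 2),
      ‖(∑ l ∈ Finset.range (d + 1), ((h * 2 ^ i : ℕ) ^ l) • a l) - a 0‖ < ε := by
    have : ∀ᶠ h : ℕ+ in (p : Filter ℕ+), ∀ i ∈ Finset.range (d + 1 + 2),
      ‖(∑ l ∈ Finset.range (d + 1), ((h * 2 ^ i : ℕ) ^ l) • a l) - a 0‖ < ε := by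
      rw [Finset.eventually_all]
      intro i _
      have h1 : Tendsto (fun h : ℕ+ => ∑ l ∈ Finset.range d,
          ((h : ℕ) ^ (l + 1)) • (((2 ^ i) ^ (l + 1) : ℕ) • a (l + 1))) p
          (𝓝 (∑ l ∈ Finset.range d, 0)) :=
        tendsto_finsetSum _ fun l _ => hp (l + 1) (by omega) _
      rw [Finset.sum_const_zero] at h1
      have h2 := (h1.norm).eventually_lt_const (u := ε) (by simpa using hε0)
      filter_upwards [h2] with h hlt
      rw [Finset.sum_range_succ']
      simpa [mul_pow, mul_smul] using hlt
    exact this.exists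
  -- find the occurrence
  have ev1 : ∀ᶠ k : ℕ in (q : Filter ℕ), ∀ i ∈ Finset.range (d + 1 + 2),
      ‖((((N k + h * 2 ^ i : ℕ) : ℝ) ^ c : ℝ) : AddCircle (m : ℝ)) - a 0‖ < ε := by
    rw [Finset.eventually_all]
    intro i hi
    exact ((hQ (h * 2 ^ i)).sub_const (a 0)).norm.eventually (gt_mem_nhds (hh i hi))
  have ev2 : ∀ s : ℕ, ∀ᶠ k : ℕ in (q : Filter ℕ), _ := fun s =>
    hNq.eventually (ps_T c (d + 1) hd2 (by push_cast; linarith) w hwk hwp (h * 2 ^ s)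
      (by have := h.pos; positivity))
  have ev3 : ∀ᶠ k : ℕ in (q : Filter ℕ), h * 2 ^ (d + 3) ≤ k :=
    Nat.hyperfilter_le_atTop (eventually_ge_atTop _)
  obtain ⟨k, hk1, hk20, hk21, hk3⟩ := (ev1.and ((ev2 0).and ((ev2 1).and ev3))).exists
  obtain ⟨θ, hθ⟩ := QuotientAddGroup.mk_surjective (a 0)
  have hz : ∀ i, ∃ z : ℤ, i < d + 1 + 2 → |((N k + h * 2 ^ i : ℕ) : ℝ) ^ c - θ - z * m| < ε := by
    intro i
    refine ⟨round ((m : ℝ)⁻¹ * (((N k + h * 2 ^ i : ℕ) : ℝ) ^ c - θ)), fun hi => ?_⟩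
    have := hk1 i (Finset.mem_range.2 hi)
    rw [← hθ] at this
    change ‖((((N k + h * 2 ^ i : ℕ) : ℝ) ^ c - θ : ℝ) : AddCircle (m : ℝ))‖ < ε at this
    rwa [AddCircle.norm_eq] at this
  choose z hz using hz
  refine ps_core (d + 1) m hm w hws hw0 ε θ hε1 hε2 (fun i => ((N k + h * 2 ^ i : ℕ) : ℝ) ^ c) z hz
    ?_ (padicValNat 2 h) ?_
  · intro s hs
    have : s = 0 ∨ s = 1 := by omega
    have e : ∀ i, (h : ℕ) * 2 ^ (i + s) = h * 2 ^ s * 2 ^ i := fun i => by ring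
    simp only [e]
    rcases this with rfl | rfl
    · exact hk20
    · exact hk21
  · intro i hi
    have hle : (h : ℕ) * 2 ^ i ≤ k := le_trans
      (Nat.mul_le_mul_left _ (Nat.pow_le_pow_right (by norm_num) (by omega))) hk3
    have h1 := hocc k _ hle
    rw [padicValNat.mul h.ne_zero (by positivity), padicValNat.prime_pow] at h1
    exact h1
end

section
/- Let c > 1 be a non-integer real number and m a positive integer. Then for every integer k with 1 ≤ k ≤ c + 1, the sequence (⌊n^c⌋)_n is k-uniformly distributed modulo m: for every block B = (b₀,…,b_{k−1}) ∈ {0,…,m−1}^k, (1/N)·#{n < N : ⌊(n+i)^c⌋ ≡ b_i (mod m) for all 0 ≤ i < k} → m^{−k} as N → ∞. -/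
open Filter

/-- Averages of a complex sequence. -/
noncomputable def psAvg (v : ℕ → ℂ) (N : ℕ) : ℂ := (∑ n ∈ Finset.range N, v n) / (N : ℂ)

lemma psAvg_cesaro {v : ℕ → ℂ} (h : Tendsto v atTop (nhds 0)) :
    Tendsto (psAvg v) atTop (nhds 0) := by
  have := h.cesaro_smul
  refine this.congr fun N => ?_
  simp [psAvg, div_eq_inv_mul]

lemma psAvg_telescope {v : ℕ → ℂ} (h : Tendsto (fun N : ℕ => v N / (N : ℂ)) atTop (nhds 0)) :
    Tendsto (psAvg (fun n => v (n + 1) - v n)) atTop (nhds 0) := by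
  have h2 : Tendsto (fun N : ℕ => v 0 / (N : ℂ)) atTop (nhds 0) :=
    tendsto_const_div_atTop_nhds_zero_nat (v 0)
  have := h.sub h2
  rw [sub_zero] at this
  refine this.congr fun N => ?_
  rw [psAvg, Finset.sum_range_sub, sub_div]

lemma psAvg_add (v w : ℕ → ℂ) (N : ℕ) : psAvg (fun n => v n + w n) N = psAvg v N + psAvg w N := by
  simp [psAvg, Finset.sum_add_distrib, add_div]

lemma psAvg_shift {v : ℕ → ℂ} (hv : ∀ n, ‖v n‖ ≤ 1) {l : ℂ} (hl : Tendsto (psAvg v) atTop (nhds l))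
    (h : ℕ) : Tendsto (psAvg (fun n => v (n + h))) atTop (nhds l) := by
  induction h with
  | zero => simpa using hl
  | succ h ih =>
    have h1 : Tendsto (fun N : ℕ => v (N + h) / (N : ℂ)) atTop (nhds 0) := by
      refine squeeze_zero_norm (a := fun N : ℕ => 1 / (N : ℝ)) (fun N => ?_)
        tendsto_one_div_atTop_nhds_zero_nat
      rw [norm_div, Complex.norm_natCast]
      gcongr
      exact hv _
    have h2 := psAvg_telescope (v := fun n => v (n + h)) h1
    have h3 := h2.add ih
    rw [zero_add] at h3
    refine h3.congr fun N => ?_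
    rw [← psAvg_add]
    congr 1
    funext n
    rw [show n + 1 + h = n + (h + 1) by ring]
    ring

lemma psAvg_sum {ι : Type*} (s : Finset ι) (v : ι → ℕ → ℂ) (N : ℕ) :
    psAvg (fun n => ∑ i ∈ s, v i n) N = ∑ i ∈ s, psAvg (v i) N := by
  simp only [psAvg]
  rw [Finset.sum_comm, Finset.sum_div]

lemma psAvg_norm_sq_le (v : ℕ → ℂ) (N : ℕ) :
    ‖psAvg v N‖ ^ 2 ≤ (psAvg (fun n => v n * (starRingEnd ℂ) (v n)) N).re := by
  have h1 : psAvg (fun n => v n * (starRingEnd ℂ) (v n)) N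
      = (((∑ n ∈ Finset.range N, ‖v n‖ ^ 2) / N : ℝ) : ℂ) := by
    simp only [psAvg, Complex.mul_conj, Complex.normSq_eq_norm_sq]
    push_cast
    rfl
  rw [h1, Complex.ofReal_re, psAvg, norm_div, Complex.norm_natCast]
  rcases Nat.eq_zero_or_pos N with rfl | hN
  · simp
  have hN' : (0 : ℝ) < N := by exact_mod_cast hN
  rw [div_pow, div_le_div_iff₀ (by positivity) hN']
  have h2 : ‖∑ n ∈ Finset.range N, v n‖ ^ 2 ≤ N * ∑ n ∈ Finset.range N, ‖v n‖ ^ 2 := by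
    calc _ ≤ (∑ n ∈ Finset.range N, ‖v n‖) ^ 2 := by
          gcongr
          exact norm_sum_le _ _
      _ ≤ _ := by
          have := sq_sum_le_card_mul_sum_sq (s := Finset.range N) (f := fun n => ‖v n‖)
          simpa using this
  nlinarith

/-- van der Corput's difference theorem. -/
lemma ps_vdc {u : ℕ → ℂ} (hu : ∀ n, ‖u n‖ = 1)
    (h : ∀ h : ℕ, 1 ≤ h → Tendsto (psAvg (fun n => u (n + h) * (starRingEnd ℂ) (u n)))
      atTop (nhds 0)) : Tendsto (psAvg u) atTop (nhds 0) := by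
  have hone : Tendsto (psAvg (fun _ => (1 : ℂ))) atTop (nhds 1) := by
    refine tendsto_const_nhds.congr' ?_
    filter_upwards [eventually_gt_atTop 0] with N hN
    have : (N : ℂ) ≠ 0 := by exact_mod_cast hN.ne'
    simp [psAvg, this]
  have hgt : ∀ a d : ℕ, 1 ≤ d →
      Tendsto (psAvg (fun n => u (n + (a + d)) * (starRingEnd ℂ) (u (n + a)))) atTop (nhds 0) := by
    intro a d hd
    have := psAvg_shift (v := fun n => u (n + d) * (starRingEnd ℂ) (u n))
      (fun n => by simp [hu]) (h d hd) a
    refine this.congr fun N => ?_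
    congr 1
    funext n
    rw [show n + a + d = n + (a + d) by ring]
  have hpair : ∀ a b : ℕ, Tendsto (psAvg (fun n => u (n + a) * (starRingEnd ℂ) (u (n + b)))) atTop
      (nhds (if a = b then 1 else 0)) := by
    intro a b
    rcases lt_trichotomy a b with hab | hab | hab
    · rw [if_neg hab.ne]
      obtain ⟨d, rfl⟩ := Nat.exists_eq_add_of_lt hab
      have h1 := (Complex.continuous_conj.tendsto 0).comp (hgt a (d + 1) (by omega))
      rw [map_zero] at h1
      refine h1.congr fun N => ?_
      simp only [psAvg, Function.comp, map_div₀, map_sum, map_mul, Complex.conj_conj,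
        Complex.conj_natCast]
      congr 1
      refine Finset.sum_congr rfl fun n _ => ?_
      rw [mul_comm, add_assoc a d 1]
    · subst hab
      rw [if_pos rfl]
      refine hone.congr fun N => ?_
      congr 1
      funext n
      rw [Complex.mul_conj, Complex.normSq_eq_norm_sq, hu]
      simp
    · rw [if_neg hab.ne']
      obtain ⟨d, rfl⟩ := Nat.exists_eq_add_of_lt hab
      exact hgt b (d + 1) (by omega)
  rw [Metric.tendsto_atTop']
  intro ε hε
  obtain ⟨H, hH⟩ := exists_nat_gt (4 / ε ^ 2)
  have hHpos : (0 : ℝ) < H := lt_trans (by positivity) hH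
  have hHc : (H : ℂ) ≠ 0 := by exact_mod_cast hHpos.ne'
  set w : ℕ → ℂ := fun n => ∑ a ∈ Finset.range H, u (n + a) with hw
  -- averages of `w`
  have hA : Tendsto (fun N => psAvg w N - H * psAvg u N) atTop (nhds 0) := by
    have h1 : ∀ a ∈ Finset.range H, Tendsto (fun N => psAvg (fun n => u (n + a)) N - psAvg u N) atTop
        (nhds 0) := by
      intro a _
      have h2 : Tendsto (psAvg (fun n => (u (n + a) - u n))) atTop (nhds 0) := by
        induction a with
        | zero =>
          have h0 : (psAvg fun n => u (n + 0) - u n) = fun _ => 0 := by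
            funext N
            simp [psAvg]
          rw [h0]
          exact tendsto_const_nhds
        | succ a ih =>
          have h3 : Tendsto (fun N : ℕ => u (N + a) / (N : ℂ)) atTop (nhds 0) := by
            refine squeeze_zero_norm (a := fun N : ℕ => 1 / (N : ℝ)) (fun N => ?_)
              tendsto_one_div_atTop_nhds_zero_nat
            rw [norm_div, Complex.norm_natCast, hu]
          have h4 := (psAvg_telescope (v := fun n => u (n + a)) h3).add (ih (by simp_all; omega))
          rw [zero_add] at h4
          refine h4.congr fun N => ?_
          rw [← psAvg_add]
          congr 1
          funext n
          rw [show n + 1 + a = n + (a + 1) by ring]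
          ring
      refine h2.congr fun N => ?_
      simp [psAvg, sub_div]
    have h2 := tendsto_finsetSum _ h1
    simp only [Finset.sum_const_zero] at h2
    refine h2.congr fun N => ?_
    rw [hw, psAvg_sum]
    simp
  have hB : Tendsto (fun N => (psAvg (fun n => w n * (starRingEnd ℂ) (w n)) N).re) atTop
      (nhds H) := by
    have h1 : Tendsto (psAvg (fun n => w n * (starRingEnd ℂ) (w n))) atTop (nhds (H : ℂ)) := by
      have h2 : Tendsto (fun N => ∑ a ∈ Finset.range H, ∑ b ∈ Finset.range H,
          psAvg (fun n => u (n + a) * (starRingEnd ℂ) (u (n + b))) N) atTop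
          (nhds (∑ a ∈ Finset.range H, ∑ b ∈ Finset.range H, (if a = b then (1:ℂ) else 0))) :=
        tendsto_finsetSum _ fun a _ => tendsto_finsetSum _ fun b _ => hpair a b
      have h3 : (∑ a ∈ Finset.range H, ∑ b ∈ Finset.range H, (if a = b then (1:ℂ) else 0)) = H := by
        rw [Finset.sum_congr rfl (g := fun _ => (1 : ℂ))]
        · simp
        · intro a ha
          rw [Finset.sum_ite_eq, if_pos ha]
      rw [h3] at h2
      refine h2.congr fun N => ?_
      simp only [← psAvg_sum]
      congr 1
      funext n
      simp only [hw, map_sum, Finset.sum_mul_sum]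
    have h4 := (Complex.continuous_re.tendsto _).comp h1
    rw [Complex.natCast_re] at h4
    exact h4
  have hε2 : 0 < H * (ε / 4) := by positivity
  have e1 := hA.norm.eventually (gt_mem_nhds (by simpa using hε2))
  have hH2 : (H : ℝ) < (H * ε / 2) ^ 2 := by
    rw [div_lt_iff₀ (by positivity)] at hH
    nlinarith
  have e2 := hB.eventually (gt_mem_nhds hH2)
  obtain ⟨N0, hN0⟩ := eventually_atTop.1 (e1.and e2)
  refine ⟨N0, fun N hN => ?_⟩
  obtain ⟨i1, i2⟩ := hN0 N hN.le
  have i3 := (psAvg_norm_sq_le w N).trans_lt i2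
  have i4 : ‖psAvg w N‖ < H * ε / 2 := lt_of_pow_lt_pow_left₀ 2 (by positivity) i3
  rw [dist_zero_right]
  have i5 : ‖(H : ℂ) * psAvg u N‖ ≤ ‖psAvg w N‖ + ‖psAvg w N - H * psAvg u N‖ := by
    have := norm_sub_le (psAvg w N) (psAvg w N - H * psAvg u N)
    simpa using this
  rw [norm_mul, Complex.norm_natCast] at i5
  have : (H : ℝ) * ‖psAvg u N‖ < H * ε := by linarith
  exact lt_of_mul_lt_mul_left this hHpos.le

/-- Fejér-type theorem (discrete version). -/
lemma ps_fejer {f δ : ℕ → ℝ} (hδ : ∀ n, f (n + 1) - f n = δ n)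
    (h0 : Tendsto δ atTop (nhds 0)) (h1 : Tendsto (fun n : ℕ => |(n : ℝ) * δ n|) atTop atTop)
    (h2 : Tendsto (fun n => (δ (n + 1) - δ n) / (δ n * δ (n + 1))) atTop (nhds 0)) :
    Tendsto (psAvg (fun n => Complex.exp (Complex.I * (f n : ℂ)))) atTop (nhds 0) := by
  set e : ℕ → ℂ := fun n => Complex.exp (Complex.I * (f n : ℂ)) with he
  set z : ℕ → ℂ := fun n => Complex.exp (Complex.I * (δ n : ℂ)) - 1 with hz
  have hen : ∀ n, ‖e n‖ = 1 := fun n => by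
    simp only [he]; rw [mul_comm]; exact Complex.norm_exp_ofReal_mul_I _
  have hne : ∀ᶠ n in atTop, δ n ≠ 0 := by
    filter_upwards [h1.eventually_gt_atTop 0] with n hn h
    simp [h] at hn
  have hlow : ∀ᶠ n in atTop, |δ n| / 2 ≤ ‖z n‖ := by
    have := h0.abs.eventually (gt_mem_nhds (show |(0:ℝ)| < 1/2 by norm_num))
    filter_upwards [this] with n hn
    have hb := Complex.norm_exp_sub_one_sub_id_le (x := Complex.I * (δ n : ℂ)) (by
      simp; linarith)
    have h3 : ‖Complex.I * (δ n : ℂ)‖ = |δ n| := by simp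
    rw [h3] at hb
    have h4 : ‖Complex.I * (δ n : ℂ)‖ ≤ ‖z n‖ + ‖Complex.exp (Complex.I * (δ n : ℂ)) - 1 -
        Complex.I * (δ n : ℂ)‖ := by
      have := norm_sub_le (z n) (z n - Complex.I * (δ n : ℂ))
      simpa [hz] using this
    rw [h3] at h4
    nlinarith [abs_nonneg (δ n)]
  set v : ℕ → ℂ := fun n => e n / z n with hv
  have hes : ∀ n, e (n + 1) = e n * (z n + 1) := by
    intro n
    simp only [he, hz, sub_add_cancel]
    rw [← Complex.exp_add, ← mul_add]
    congr 2
    rw [← Complex.ofReal_add, ← hδ]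
    simp
  have hvN : Tendsto (fun N : ℕ => v N / (N : ℂ)) atTop (nhds 0) := by
    have h3 : Tendsto (fun n : ℕ => 2 * |(n : ℝ) * δ n|⁻¹) atTop (nhds 0) := by
      simpa using h1.inv_tendsto_atTop.const_mul 2
    refine squeeze_zero_norm' ?_ h3
    filter_upwards [hlow, hne, eventually_gt_atTop 0] with n hn hn2 hn3
    have hp := abs_pos.2 hn2
    have hn3' : (0:ℝ) < n := by exact_mod_cast hn3
    simp only [hv]
    rw [norm_div, norm_div, hen, Complex.norm_natCast, abs_mul, Nat.abs_cast]
    calc 1 / ‖z n‖ / n ≤ 1 / (|δ n| / 2) / n := by gcongr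
      _ = _ := by field_simp
  have hr : Tendsto (fun n => e n - (v (n + 1) - v n)) atTop (nhds 0) := by
    have h3 : Tendsto (fun n => 4 * |(δ (n + 1) - δ n) / (δ n * δ (n + 1))|) atTop (nhds 0) := by
      simpa using h2.abs.const_mul 4
    refine squeeze_zero_norm' ?_ h3
    filter_upwards [hlow, hne, (tendsto_add_atTop_nat 1).eventually hlow,
      (tendsto_add_atTop_nat 1).eventually hne] with n a1 a2 a3 a4
    have p1 := abs_pos.2 a2
    have p2 := abs_pos.2 a4
    have z1 : z n ≠ 0 := norm_pos_iff.1 (by linarith)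
    have z2 : z (n + 1) ≠ 0 := norm_pos_iff.1 (by linarith)
    have : e n - (v (n + 1) - v n) = e (n + 1) * ((z (n + 1) - z n) / (z n * z (n + 1))) := by
      simp only [hv]
      rw [hes]
      field_simp
      ring
    rw [this, norm_mul, hen, one_mul, norm_div, norm_mul, abs_div, abs_mul]
    have h5 : ‖z (n + 1) - z n‖ ≤ |δ (n + 1) - δ n| := by
      have : z (n + 1) - z n = Complex.exp (Complex.I * (δ n : ℂ)) *
          (Complex.exp (Complex.I * ((δ (n + 1) - δ n : ℝ) : ℂ)) - 1) := by
        rw [mul_sub, ← Complex.exp_add, ← mul_add]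
        simp [hz]
      rw [this, norm_mul]
      have h6 : ‖Complex.exp (Complex.I * (δ n : ℂ))‖ = 1 := by
        rw [mul_comm]; exact Complex.norm_exp_ofReal_mul_I _
      rw [h6, one_mul]
      exact Real.norm_exp_I_mul_ofReal_sub_one_le
    calc _ ≤ |δ (n + 1) - δ n| / ((|δ n| / 2) * (|δ (n + 1)| / 2)) := by gcongr
      _ = _ := by field_simp; norm_num
  have := (psAvg_telescope hvN).add (psAvg_cesaro hr)
  rw [zero_add] at this
  refine this.congr fun N => ?_
  rw [← psAvg_add]
  congr 1
  funext n
  ring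

lemma ps_choose_ne_zero {c : ℝ} (hc : ∀ n : ℤ, c ≠ (n : ℝ)) (j : ℕ) : Ring.choose c j ≠ 0 := by
  have h1 : (descPochhammer ℤ j).smeval c ≠ 0 := by
    induction j with
    | zero => simp
    | succ j ih =>
      rw [descPochhammer_succ_right, Polynomial.smeval_mul]
      refine mul_ne_zero ih ?_
      rw [Polynomial.smeval_sub, Polynomial.smeval_X, Polynomial.smeval_natCast]
      have := hc j
      simp only [pow_one, pow_zero, nsmul_eq_mul, mul_one]
      exact sub_ne_zero.2 (by exact_mod_cast this)
  rw [Ring.choose_eq_smul]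
  exact smul_ne_zero (by positivity) h1

lemma ps_asymp_one (c t : ℝ) (j : ℕ) :
    Tendsto (fun n : ℕ => (n : ℝ) ^ j * ((1 + t / n) ^ c
      - ∑ l ∈ Finset.range j, Ring.choose c l * (t / n) ^ l)) atTop
      (nhds (Ring.choose c j * t ^ j)) := by
  have h1 := (Real.one_add_rpow_hasFPowerSeriesAt_zero (a := c)).isBigO_sub_partialSum_pow (j + 1)
  have ht : Tendsto (fun n : ℕ => t / (n : ℝ)) atTop (nhds 0) :=
    tendsto_const_div_atTop_nhds_zero_nat t
  have h2 := h1.comp_tendsto ht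
  have hps : ∀ y : ℝ, (binomialSeries ℝ c).partialSum (j + 1) y
      = ∑ l ∈ Finset.range (j + 1), Ring.choose c l * y ^ l := by
    intro y
    simp [FormalMultilinearSeries.partialSum, binomialSeries,
      FormalMultilinearSeries.coeff_ofScalars, mul_comm]
  obtain ⟨C, hC⟩ := h2.bound
  have h3 : Tendsto (fun n : ℕ => (n : ℝ) ^ j * ((1 + t / n) ^ c
      - ∑ l ∈ Finset.range (j + 1), Ring.choose c l * (t / n) ^ l)) atTop (nhds 0) := by
    refine squeeze_zero_norm' (a := fun n : ℕ => (C * |t| ^ (j + 1)) / (n : ℝ)) ?_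
      (tendsto_const_div_atTop_nhds_zero_nat _)
    filter_upwards [hC, eventually_gt_atTop 0] with n hn hn0
    have hn0' : (0 : ℝ) < n := by exact_mod_cast hn0
    simp only [Function.comp, zero_add, hps, norm_pow, norm_div,
      Real.norm_eq_abs, abs_abs, Nat.abs_cast] at hn
    rw [norm_mul, norm_pow, Real.norm_natCast, Real.norm_eq_abs]
    calc _ ≤ (n : ℝ) ^ j * (C * (|t| / n) ^ (j + 1)) := by gcongr
      _ = _ := by rw [div_pow]; field_simp; ring
  have h4 := h3.add_const (Ring.choose c j * t ^ j)
  rw [zero_add] at h4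
  refine h4.congr' ?_
  filter_upwards [eventually_gt_atTop 0] with n hn0
  have hn0' : (n : ℝ) ≠ 0 := by exact_mod_cast hn0.ne'
  rw [Finset.sum_range_succ]
  have : (n : ℝ) ^ j * (t / n) ^ j = t ^ j := by rw [← mul_pow]; field_simp
  rw [← this]
  ring

/-- Linear combinations of shifted powers. -/
noncomputable def psF {ι : Type} [Fintype ι] (c : ℝ) (a t : ι → ℝ) (x : ℝ) : ℝ :=
  ∑ i, a i * (x + t i) ^ c

/-- Moments of the coefficients. -/
noncomputable def psM {ι : Type} [Fintype ι] (a t : ι → ℝ) (l : ℕ) : ℝ := ∑ i, a i * t i ^ l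

lemma ps_asymp {ι : Type} [Fintype ι] (c : ℝ) (a t : ι → ℝ) (j : ℕ)
    (hM : ∀ l < j, psM a t l = 0) :
    Tendsto (fun n : ℕ => (n : ℝ) ^ ((j : ℝ) - c) * psF c a t n) atTop
      (nhds (Ring.choose c j * psM a t j)) := by
  have h1 : Tendsto (fun n : ℕ => ∑ i, a i * ((n : ℝ) ^ j * ((1 + t i / n) ^ c
      - ∑ l ∈ Finset.range j, Ring.choose c l * (t i / n) ^ l))) atTop
      (nhds (∑ i, a i * (Ring.choose c j * t i ^ j))) :=
    tendsto_finsetSum _ fun i _ => (ps_asymp_one c (t i) j).const_mul _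
  have h2 : (∑ i, a i * (Ring.choose c j * t i ^ j)) = Ring.choose c j * psM a t j := by
    rw [psM, Finset.mul_sum]
    exact Finset.sum_congr rfl fun i _ => by ring
  rw [h2] at h1
  refine h1.congr' ?_
  have hpos : ∀ᶠ n : ℕ in atTop, ∀ i, 0 < 1 + t i / n := by
    rw [eventually_all]
    intro i
    have : Tendsto (fun n : ℕ => 1 + t i / (n : ℝ)) atTop (nhds (1 + 0)) :=
      (tendsto_const_div_atTop_nhds_zero_nat _).const_add 1
    exact this.eventually (lt_mem_nhds (by norm_num))
  filter_upwards [hpos, eventually_gt_atTop 0] with n hn hn0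
  have hn0' : (0 : ℝ) < n := by exact_mod_cast hn0
  have h3 : ∑ i, a i * ((n : ℝ) ^ j * ∑ l ∈ Finset.range j, Ring.choose c l * (t i / n) ^ l) = 0 := by
    simp only [Finset.mul_sum]
    rw [Finset.sum_comm]
    refine Finset.sum_eq_zero fun l hl => ?_
    have := hM l (Finset.mem_range.1 hl)
    calc _ = ((n : ℝ) ^ j * Ring.choose c l / n ^ l) * psM a t l := by
          rw [psM, Finset.mul_sum]
          refine Finset.sum_congr rfl fun i _ => ?_
          rw [div_pow]
          ring
      _ = 0 := by rw [this, mul_zero]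
  simp only [mul_sub, Finset.sum_sub_distrib]
  rw [h3, sub_zero, psF, Finset.mul_sum]
  refine Finset.sum_congr rfl fun i _ => ?_
  have h4 : (n : ℝ) + t i = n * (1 + t i / n) := by field_simp
  rw [h4, Real.mul_rpow hn0'.le (hn i).le, Real.rpow_sub hn0', Real.rpow_natCast]
  have : (n : ℝ) ^ c ≠ 0 := (Real.rpow_pos_of_pos hn0' c).ne'
  field_simp

lemma psF_diff {ι : Type} [Fintype ι] (c : ℝ) (a t : ι → ℝ) (h x : ℝ) :
    psF c (Sum.elim a (fun i => - a i)) (Sum.elim (fun i => t i + h) t) x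
      = psF c a t (x + h) - psF c a t x := by
  simp only [psF, Fintype.sum_sum_type, Sum.elim_inl, Sum.elim_inr, neg_mul,
    Finset.sum_neg_distrib, ← sub_eq_add_neg]
  congr 1
  refine Finset.sum_congr rfl fun i _ => ?_
  rw [show x + (t i + h) = x + h + t i by ring]

lemma psM_diff_aux {ι : Type} [Fintype ι] (a t : ι → ℝ) (h : ℝ) (l : ℕ) :
    psM (Sum.elim a (fun i => - a i)) (Sum.elim (fun i => t i + h) t) l
      = ∑ r ∈ Finset.range l, psM a t r * h ^ (l - r) * (l.choose r : ℝ) := by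
  simp only [psM, Fintype.sum_sum_type, Sum.elim_inl, Sum.elim_inr, neg_mul,
    Finset.sum_neg_distrib, ← sub_eq_add_neg]
  simp only [add_pow, Finset.sum_range_succ, mul_add, Finset.sum_add_distrib]
  simp only [Nat.sub_self, pow_zero, mul_one, Nat.choose_self, Nat.cast_one, add_sub_cancel_right]
  simp only [Finset.mul_sum, Finset.sum_mul]
  rw [Finset.sum_comm]
  refine Finset.sum_congr rfl fun r _ => Finset.sum_congr rfl fun i _ => by ring

lemma psM_diff_zero {ι : Type} [Fintype ι] (a t : ι → ℝ) (h : ℝ) (j : ℕ)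
    (hM : ∀ l < j, psM a t l = 0) : ∀ l < j + 1,
    psM (Sum.elim a (fun i => - a i)) (Sum.elim (fun i => t i + h) t) l = 0 := by
  intro l hl
  rw [psM_diff_aux]
  refine Finset.sum_eq_zero fun r hr => ?_
  rw [hM r (by have := Finset.mem_range.1 hr; omega)]
  ring

lemma psM_diff_succ {ι : Type} [Fintype ι] (a t : ι → ℝ) (h : ℝ) (j : ℕ)
    (hM : ∀ l < j, psM a t l = 0) :
    psM (Sum.elim a (fun i => - a i)) (Sum.elim (fun i => t i + h) t) (j + 1)
      = psM a t j * h * (j + 1) := by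
  rw [psM_diff_aux, Finset.sum_range_succ, Finset.sum_eq_zero]
  · simp
  · intro r hr
    rw [hM r (Finset.mem_range.1 hr)]
    ring

lemma ps_weyl_base {c : ℝ} (hc : ∀ n : ℤ, c ≠ (n : ℝ)) {ι : Type} [Fintype ι] (a t : ι → ℝ)
    (j : ℕ) (hj : (j : ℝ) < c) (hj1 : c < j + 1) (hM : ∀ l < j, psM a t l = 0)
    (hMj : psM a t j ≠ 0) :
    Tendsto (psAvg (fun n => Complex.exp (Complex.I * (psF c a t n : ℂ)))) atTop (nhds 0) := by
  set a1 := Sum.elim a (fun i => - a i) with ha1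
  set t1 := Sum.elim (fun i => t i + 1) t with ht1
  set a2 := Sum.elim a1 (fun i => - a1 i) with ha2
  set t2 := Sum.elim (fun i => t1 i + 1) t1 with ht2
  have M1 := psM_diff_zero a t 1 j hM
  have M1' := psM_diff_succ a t 1 j hM
  rw [← ha1, ← ht1] at M1 M1'
  have M2 := psM_diff_zero a1 t1 1 (j + 1) M1
  rw [← ha2, ← ht2] at M2
  have A1 := ps_asymp c a1 t1 (j + 1) M1
  have A2 := ps_asymp c a2 t2 (j + 1 + 1) M2
  have hA : Ring.choose c (j + 1) * psM a1 t1 (j + 1) ≠ 0 := by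
    refine mul_ne_zero (ps_choose_ne_zero hc _) ?_
    rw [M1', mul_one]
    exact mul_ne_zero hMj (by positivity)
  set A := Ring.choose c (j + 1) * psM a1 t1 (j + 1) with hAdef
  set B := Ring.choose c (j + 1 + 1) * psM a2 t2 (j + 1 + 1) with hBdef
  set δ : ℕ → ℝ := fun n => psF c a1 t1 n with hδ
  have hδ2 : ∀ n : ℕ, psF c a2 t2 n = δ (n + 1) - δ n := by
    intro n
    rw [ha2, ht2, psF_diff]
    simp [hδ]
  simp only [hδ2] at A2
  push_cast at A1 A2
  -- powers
  have P : ∀ s : ℝ, 0 < s → Tendsto (fun n : ℕ => (n : ℝ) ^ (-s)) atTop (nhds 0) := fun s hs =>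
    (tendsto_rpow_neg_atTop hs).comp tendsto_natCast_atTop_atTop
  have PT : ∀ s : ℝ, 0 < s → Tendsto (fun n : ℕ => (n : ℝ) ^ s) atTop atTop := fun s hs =>
    (tendsto_rpow_atTop hs).comp tendsto_natCast_atTop_atTop
  have A3 : Tendsto (fun n : ℕ => (n : ℝ) ^ ((j : ℝ) + 1 - c) * δ (n + 1)) atTop (nhds A) := by
    have h1 := A1.add ((P 1 one_pos).mul A2)
    rw [zero_mul, add_zero] at h1
    refine h1.congr' ?_
    filter_upwards [eventually_gt_atTop 0] with n hn0
    have hn0' : (0 : ℝ) < n := by exact_mod_cast hn0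
    rw [← mul_assoc, ← Real.rpow_add hn0', show (-1 : ℝ) + (j + 1 + 1 - c) = j + 1 - c by ring]
    ring
  refine ps_fejer (δ := δ) ?_ ?_ ?_ ?_
  · intro n
    simp only [hδ]
    rw [ha1, ht1, psF_diff]
    push_cast
    rfl
  · have h1 := (P (j + 1 - c) (by linarith)).mul A1
    rw [zero_mul] at h1
    refine h1.congr' ?_
    filter_upwards [eventually_gt_atTop 0] with n hn0
    have hn0' : (0 : ℝ) < n := by exact_mod_cast hn0
    rw [← mul_assoc, ← Real.rpow_add hn0', neg_add_cancel, Real.rpow_zero, one_mul]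
  · have h1 := (PT (c - j) (by linarith)).atTop_mul_pos (abs_pos.2 hA) A1.abs
    refine h1.congr' ?_
    filter_upwards [eventually_gt_atTop 0] with n hn0
    have hn0' : (0 : ℝ) < n := by exact_mod_cast hn0
    rw [← abs_of_pos (Real.rpow_pos_of_pos hn0' (c - j)), ← abs_mul, ← mul_assoc,
      ← Real.rpow_add hn0', show c - j + (j + 1 - c) = 1 by ring, Real.rpow_one]
  · have h1 := (P (c - j) (by linarith)).mul (A2.div (A1.mul A3) (mul_ne_zero hA hA))
    rw [zero_mul] at h1
    refine h1.congr' ?_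
    filter_upwards [eventually_gt_atTop 0] with n hn0
    have hn0' : (0 : ℝ) < n := by exact_mod_cast hn0
    have e1 : (n : ℝ) ^ (-(c - j)) * (n : ℝ) ^ ((j : ℝ) + 1 + 1 - c)
        = (n : ℝ) ^ ((j : ℝ) + 1 - c) * (n : ℝ) ^ ((j : ℝ) + 1 - c) := by
      rw [← Real.rpow_add hn0', ← Real.rpow_add hn0']
      congr 1
      ring
    have hp := (Real.rpow_pos_of_pos hn0' ((j : ℝ) + 1 - c)).ne'
    calc _ = ((n : ℝ) ^ (-(c - j)) * (n : ℝ) ^ ((j : ℝ) + 1 + 1 - c)) * (δ (n + 1) - δ n) /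
          (((n : ℝ) ^ ((j : ℝ) + 1 - c) * (n : ℝ) ^ ((j : ℝ) + 1 - c)) * (δ n * δ (n + 1))) := by
          simp only [Pi.div_apply, hδ]
          ring
      _ = _ := by rw [e1, mul_div_mul_left _ _ (mul_ne_zero hp hp)]

lemma ps_weyl {c : ℝ} (hc : ∀ n : ℤ, c ≠ (n : ℝ)) (d : ℕ) : ∀ {ι : Type} [Fintype ι] (a t : ι → ℝ)
    (j : ℕ) (_ : ((j + d : ℕ) : ℝ) < c) (_ : c < (j + d : ℕ) + 1) (_ : ∀ l < j, psM a t l = 0)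
    (_ : psM a t j ≠ 0),
    Tendsto (psAvg (fun n => Complex.exp (Complex.I * (psF c a t n : ℂ)))) atTop (nhds 0) := by
  induction d with
  | zero =>
    intro ι _ a t j h1 h2 h3 h4
    exact ps_weyl_base hc a t j h1 h2 h3 h4
  | succ d ih =>
    intro ι _ a t j h1 h2 h3 h4
    refine ps_vdc (fun n => by rw [mul_comm]; exact Complex.norm_exp_ofReal_mul_I _) ?_
    intro h hh
    have key := ih (Sum.elim a (fun i => - a i)) (Sum.elim (fun i => t i + h) t) (j + 1)
      (by rw [show j + 1 + d = j + (d + 1) by ring]; exact h1)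
      (by rw [show j + 1 + d = j + (d + 1) by ring]; exact h2)
      (psM_diff_zero a t h j h3)
      (by
        rw [psM_diff_succ a t h j h3]
        have : (h : ℝ) ≠ 0 := by exact_mod_cast (by omega : h ≠ 0)
        exact mul_ne_zero (mul_ne_zero h4 this) (by positivity))
    refine key.congr fun N => ?_
    congr 1
    funext n
    rw [psF_diff, ← Complex.exp_conj, ← Complex.exp_add]
    simp only [map_mul, Complex.conj_I, Complex.conj_ofReal]
    push_cast
    congr 1
    ring

/-- Exponential sums attached to a nonzero integer vector. -/
lemma ps_exp_sum {c : ℝ} (hc0 : 0 < c) (hc : ∀ n : ℤ, c ≠ (n : ℝ)) (k : ℕ) (hkc : (k : ℝ) ≤ c + 1)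
    (a : Fin k → ℝ) (ha : a ≠ 0) :
    Tendsto (psAvg (fun n => Complex.exp (Complex.I *
      ((∑ i, a i * (((n + i : ℕ) : ℝ)) ^ c : ℝ) : ℂ)))) atTop (nhds 0) := by
  classical
  set t : Fin k → ℝ := fun i => ((i : ℕ) : ℝ) with ht
  have hex : ∃ l, l < k ∧ psM a t l ≠ 0 := by
    by_contra hcon
    push Not at hcon
    apply ha
    refine Matrix.eq_zero_of_forall_pow_sum_mul_pow_eq_zero (f := t) ?_ ?_
    · intro x y hxy
      exact Fin.ext (Nat.cast_injective (R := ℝ) hxy)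
    · intro i
      exact hcon i i.2
  obtain ⟨hjk, hMj⟩ := Nat.find_spec hex
  have hmin : ∀ l < Nat.find hex, psM a t l = 0 := by
    intro l hl
    have := Nat.find_min hex hl
    by_contra h
    exact this ⟨hl.trans hjk, h⟩
  set j := Nat.find hex with hj
  have hjc : (j : ℝ) < c := by
    have h1 : (j : ℝ) + 1 ≤ k := by exact_mod_cast hjk
    have h2 : c ≠ (j : ℝ) := by exact_mod_cast hc j
    exact lt_of_le_of_ne (by linarith) (Ne.symm h2)
  have hjf : j ≤ ⌊c⌋₊ := Nat.le_floor hjc.le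
  have key := ps_weyl hc (⌊c⌋₊ - j) a t j
    (by
      rw [Nat.add_sub_cancel' hjf]
      have h2 : c ≠ (⌊c⌋₊ : ℝ) := by exact_mod_cast hc ⌊c⌋₊
      exact lt_of_le_of_ne (Nat.floor_le hc0.le) (Ne.symm h2))
    (by rw [Nat.add_sub_cancel' hjf]; exact Nat.lt_floor_add_one c) hmin hMj
  refine key.congr fun N => ?_
  congr 1
  funext n
  simp [psF, ht]

open MeasureTheory in
/-- The Haar probability measure on the torus. -/
noncomputable def psHaar (k : ℕ) : Measure (Fin k → UnitAddCircle) :=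
  Measure.pi (fun _ => (AddCircle.haarAddCircle : Measure UnitAddCircle))

open MeasureTheory in
instance psHaar_prob (k : ℕ) : IsProbabilityMeasure (psHaar k) := by
  unfold psHaar; infer_instance

open MeasureTheory in
lemma ps_integral_fourier {n : ℤ} (hn : n ≠ 0) :
    ∫ x : UnitAddCircle, fourier n x ∂AddCircle.haarAddCircle = 0 :=
  integral_eq_zero_of_add_right_eq_neg (fourier_add_half_inv_index hn one_pos)

open MeasureTheory in
lemma ps_integral_mFourier {k : ℕ} {h : Fin k → ℤ} (hh : h ≠ 0) :
    ∫ x, UnitAddTorus.mFourier h x ∂(psHaar k) = 0 := by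
  have h1 := integral_fintype_prod_eq_prod (𝕜 := ℂ) (fun i (y : UnitAddCircle) => fourier (h i) y)
    (μ := fun _ : Fin k => (AddCircle.haarAddCircle : Measure UnitAddCircle))
  obtain ⟨i, hi⟩ := Function.ne_iff.1 hh
  rw [psHaar]
  refine Eq.trans ?_ (h1.trans ?_)
  · rfl
  · exact Finset.prod_eq_zero (Finset.mem_univ i) (ps_integral_fourier hi)

lemma psAvg_norm_le {v : ℕ → ℂ} {C : ℝ} (hC : 0 ≤ C) (hv : ∀ n, ‖v n‖ ≤ C) (N : ℕ) :
    ‖psAvg v N‖ ≤ C := by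
  rw [psAvg, norm_div, Complex.norm_natCast]
  refine div_le_of_le_mul₀ (by positivity) hC ?_
  refine (norm_sum_le _ _).trans ((Finset.sum_le_sum fun n _ => hv n).trans ?_)
  simp [mul_comm]

open MeasureTheory in
/-- Weyl's criterion on the torus. -/
lemma ps_weyl_criterion {k : ℕ} (x : ℕ → (Fin k → UnitAddCircle))
    (hx : ∀ h : Fin k → ℤ, h ≠ 0 →
      Tendsto (psAvg (fun n => UnitAddTorus.mFourier h (x n))) atTop (nhds 0))
    (f : C(Fin k → UnitAddCircle, ℂ)) :
    Tendsto (psAvg (fun n => f (x n))) atTop (nhds (∫ y, f y ∂(psHaar k))) := by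
  have hint : ∀ g : C(Fin k → UnitAddCircle, ℂ), Integrable (fun y => g y) (psHaar k) := fun g =>
    g.continuous.integrable_of_hasCompactSupport (HasCompactSupport.of_compactSpace _)
  have hspan : ∀ g ∈ Submodule.span ℂ (Set.range (UnitAddTorus.mFourier (d := Fin k))),
      Tendsto (psAvg (fun n => g (x n))) atTop (nhds (∫ y, g y ∂(psHaar k))) := by
    intro g hg
    induction hg using Submodule.span_induction with
    | mem g hg =>
      obtain ⟨h, rfl⟩ := hg
      by_cases hh : h = 0
      · subst hh
        simp only [UnitAddTorus.mFourier_zero, ContinuousMap.one_apply, integral_const]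
        refine tendsto_const_nhds.congr' ?_
        filter_upwards [eventually_gt_atTop 0] with N hN
        have : (N : ℂ) ≠ 0 := by exact_mod_cast hN.ne'
        simp [psAvg, this]
      · rw [ps_integral_mFourier hh]
        exact hx h hh
    | zero =>
      have h0 : (psAvg fun n => (0 : C(Fin k → UnitAddCircle, ℂ)) (x n)) = fun _ => 0 := by
        funext N
        simp [psAvg]
      rw [h0]
      simp
    | add g₁ g₂ _ _ h₁ h₂ =>
      simp only [ContinuousMap.add_apply]
      rw [integral_add (hint g₁) (hint g₂)]
      refine (h₁.add h₂).congr fun N => ?_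
      rw [← psAvg_add]
    | smul r g _ hg =>
      simp only [ContinuousMap.smul_apply, smul_eq_mul]
      rw [integral_const_mul]
      refine (hg.const_mul r).congr fun N => ?_
      simp [psAvg, ← Finset.mul_sum, mul_div_assoc]
  have hf : f ∈ closure (Submodule.span ℂ (Set.range (UnitAddTorus.mFourier (d := Fin k))) :
      Set C(Fin k → UnitAddCircle, ℂ)) := by
    have h1 := UnitAddTorus.span_mFourier_closure_eq_top (d := Fin k)
    have h2 : f ∈ (Submodule.span ℂ (Set.range (UnitAddTorus.mFourier (d := Fin k)))).topologicalClosure := by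
      rw [h1]; trivial
    exact h2
  rw [Metric.tendsto_atTop]
  intro ε hε
  obtain ⟨g, hg, hfg⟩ := Metric.mem_closure_iff.1 hf (ε / 3) (by positivity)
  obtain ⟨N0, hN0⟩ := Metric.tendsto_atTop.1 (hspan g hg) (ε / 3) (by positivity)
  refine ⟨N0, fun N hN => ?_⟩
  have h1 := hN0 N hN
  have hb : ∀ y, ‖f y - g y‖ ≤ dist f g := by
    intro y
    rw [← dist_eq_norm]
    exact ContinuousMap.dist_apply_le_dist y
  have h2 : dist (psAvg (fun n => f (x n)) N) (psAvg (fun n => g (x n)) N) ≤ dist f g := by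
    rw [dist_eq_norm]
    have : psAvg (fun n => f (x n)) N - psAvg (fun n => g (x n)) N
        = psAvg (fun n => f (x n) - g (x n)) N := by
      simp [psAvg, sub_div]
    rw [this]
    exact psAvg_norm_le dist_nonneg (fun n => hb _) N
  have h3 : dist (∫ y, g y ∂(psHaar k)) (∫ y, f y ∂(psHaar k)) ≤ dist f g := by
    rw [dist_comm, dist_eq_norm, ← integral_sub (hint f) (hint g)]
    have := norm_integral_le_of_norm_le_const (μ := psHaar k) (f := fun y => f y - g y)
      (C := dist f g) (Eventually.of_forall hb)
    simpa using this
  calc _ ≤ dist (psAvg (fun n => f (x n)) N) (psAvg (fun n => g (x n)) N)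
        + dist (psAvg (fun n => g (x n)) N) (∫ y, g y ∂(psHaar k))
        + dist (∫ y, g y ∂(psHaar k)) (∫ y, f y ∂(psHaar k)) := dist_triangle4 _ _ _ _
    _ < ε := by linarith

open MeasureTheory in
/-- Empirical measures. -/
noncomputable def psEmp {k : ℕ} (x : ℕ → (Fin k → UnitAddCircle)) (N : ℕ) :
    ProbabilityMeasure (Fin k → UnitAddCircle) :=
  ⟨((N + 1 : ℕ) : ENNReal)⁻¹ • ∑ n ∈ Finset.range (N + 1), Measure.dirac (x n), ⟨by
    simp only [Measure.smul_apply, Measure.finsetSum_apply, measure_univ, Finset.sum_const,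
      Finset.card_range, nsmul_eq_mul, mul_one, smul_eq_mul]
    exact ENNReal.inv_mul_cancel (by simp) (ENNReal.natCast_ne_top _)⟩⟩

open MeasureTheory in
/-- The Haar measure as a bundled probability measure. -/
noncomputable def psHaarP (k : ℕ) : ProbabilityMeasure (Fin k → UnitAddCircle) :=
  ⟨psHaar k, psHaar_prob k⟩

open MeasureTheory in
lemma psHaarP_coe (k : ℕ) : ((psHaarP k : ProbabilityMeasure _) : Measure _) = psHaar k := rfl

open MeasureTheory in
lemma psEmp_coe {k : ℕ} (x : ℕ → (Fin k → UnitAddCircle)) (N : ℕ) :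
    ((psEmp x N : ProbabilityMeasure _) : Measure _) =
      ((N + 1 : ℕ) : ENNReal)⁻¹ • ∑ n ∈ Finset.range (N + 1), Measure.dirac (x n) := rfl

open MeasureTheory in
lemma ps_equidist {k : ℕ} (x : ℕ → (Fin k → UnitAddCircle))
    (hx : ∀ h : Fin k → ℤ, h ≠ 0 →
      Tendsto (psAvg (fun n => UnitAddTorus.mFourier h (x n))) atTop (nhds 0))
    (E : Set (Fin k → UnitAddCircle)) (hE : psHaar k (frontier E) = 0) (hEm : MeasurableSet E) :
    Tendsto (fun N : ℕ => (Set.ncard {n : ℕ | n < N ∧ x n ∈ E} : ℝ) / N) atTop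
      (nhds ((psHaar k).real E)) := by
  classical
  have hconv : Tendsto (psEmp x) atTop (nhds (psHaarP k)) := by
    rw [ProbabilityMeasure.tendsto_iff_forall_integral_rclike_tendsto ℂ]
    intro f
    rw [psHaarP_coe]
    have h1 := (tendsto_add_atTop_iff_nat 1).2 (ps_weyl_criterion x hx f.toContinuousMap)
    refine h1.congr fun N => ?_
    rw [psEmp_coe, integral_smul_measure, integral_finsetSum_measure]
    · rw [ENNReal.toReal_inv, ENNReal.toReal_natCast]
      simp [psAvg, integral_dirac, div_eq_inv_mul]
    · intro n _
      exact integrable_dirac (by simp)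
  have h2 := ProbabilityMeasure.tendsto_measure_of_null_frontier_of_tendsto hconv (E := E) (by
    rw [ProbabilityMeasure.null_iff_toMeasure_null, psHaarP_coe]
    exact hE)
  have h3 := (NNReal.tendsto_coe.2 h2)
  rw [← tendsto_add_atTop_iff_nat 1]
  refine h3.congr fun N => ?_
  have hset : {n : ℕ | n < N + 1 ∧ x n ∈ E} = ((Finset.range (N + 1)).filter (fun n => x n ∈ E) : Set ℕ) := by
    ext n
    simp
  rw [hset, Set.ncard_coe_finset]
  change ((((N + 1 : ℕ) : ENNReal)⁻¹ • ∑ n ∈ Finset.range (N + 1), Measure.dirac (x n) :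
    Measure _) E).toReal = _
  simp only [Measure.smul_apply, Measure.finsetSum_apply, Measure.dirac_apply' _ hEm, smul_eq_mul,
    ENNReal.toReal_mul, ENNReal.toReal_inv, ENNReal.toReal_natCast]
  have : ∑ n ∈ Finset.range (N + 1), E.indicator (1 : (Fin k → UnitAddCircle) → ENNReal) (x n)
      = (((Finset.range (N + 1)).filter (fun n => x n ∈ E)).card : ENNReal) := by
    rw [Finset.card_filter]
    push_cast
    refine Finset.sum_congr rfl fun n _ => ?_
    simp [Set.indicator_apply]
  rw [this, ENNReal.toReal_natCast, div_eq_inv_mul]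

/-- Half-open arcs of the circle. -/
def psArc (t s : ℝ) : Set UnitAddCircle := (fun x : ℝ => (x : UnitAddCircle)) '' Set.Ico t s

lemma ps_coe_eq {x y : ℝ} (h : (x : UnitAddCircle) = (y : UnitAddCircle)) : ∃ z : ℤ, x = y + z := by
  rw [← sub_eq_zero, ← AddCircle.coe_sub, AddCircle.coe_eq_zero_iff] at h
  obtain ⟨z, hz⟩ := h
  refine ⟨z, ?_⟩
  simp at hz
  linarith

lemma ps_coe_add (y : ℝ) (z : ℤ) : ((y + z : ℝ) : UnitAddCircle) = (y : UnitAddCircle) := by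
  rw [← sub_eq_zero, ← AddCircle.coe_sub, AddCircle.coe_eq_zero_iff]
  exact ⟨z, by simp⟩

open MeasureTheory in
lemma ps_volume_eq : (volume : Measure UnitAddCircle) = AddCircle.haarAddCircle := by
  rw [AddCircle.volume_eq_smul_haarAddCircle]
  simp

lemma psArc_measurable (t s : ℝ) : MeasurableSet (psArc t s) := by
  by_cases h : t < s
  · have : psArc t s = {(t : UnitAddCircle)} ∪ (fun x : ℝ => (x : UnitAddCircle)) '' Set.Ioo t s := by
      rw [psArc, ← Set.Ioo_union_left h, Set.image_union, Set.image_singleton, Set.union_comm]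
    rw [this]
    refine (measurableSet_singleton _).union (IsOpen.measurableSet ?_)
    exact QuotientAddGroup.isOpenMap_coe _ isOpen_Ioo
  · simp [psArc, Set.Ico_eq_empty h]

open MeasureTheory in
lemma psArc_frontier {t s : ℝ} (h : t < s) :
    (AddCircle.haarAddCircle : Measure UnitAddCircle) (frontier (psArc t s)) = 0 := by
  rw [← ps_volume_eq]
  have hcont : Continuous (fun x : ℝ => (x : UnitAddCircle)) := AddCircle.continuous_mk' 1
  have hcl : closure (psArc t s) ⊆ (fun x : ℝ => (x : UnitAddCircle)) '' Set.Icc t s := by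
    refine closure_minimal (Set.image_mono Set.Ico_subset_Icc_self) ?_
    exact (isCompact_Icc.image hcont).isClosed
  have hin : (fun x : ℝ => (x : UnitAddCircle)) '' Set.Ioo t s ⊆ interior (psArc t s) := by
    refine interior_maximal (Set.image_mono Set.Ioo_subset_Ico_self) ?_
    exact QuotientAddGroup.isOpenMap_coe _ isOpen_Ioo
  have hpt : ∀ y : UnitAddCircle, (volume : Measure UnitAddCircle) {y} = 0 := by
    intro y
    have := AddCircle.volume_closedBall (T := (1 : ℝ)) (x := y) 0
    simpa using this
  have hsub : frontier (psArc t s) ⊆ {(t : UnitAddCircle)} ∪ {(s : UnitAddCircle)} := by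
    intro y hy
    obtain ⟨r, hr, rfl⟩ := hcl hy.1
    by_cases h1 : r = t
    · left; simp [h1]
    by_cases h2 : r = s
    · right; simp [h2]
    exact absurd (hin ⟨r, ⟨lt_of_le_of_ne hr.1 (Ne.symm h1), lt_of_le_of_ne hr.2 h2⟩, rfl⟩) hy.2
  exact measure_mono_null hsub (measure_union_null (hpt _) (hpt _))

open MeasureTheory in
lemma psArc_haar {t s : ℝ} (h : t < s) (hs : s ≤ t + 1) :
    (AddCircle.haarAddCircle : Measure UnitAddCircle) (psArc t s) = ENNReal.ofReal (s - t) := by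
  rw [← ps_volume_eq]
  have h1 := (AddCircle.measurePreserving_mk 1 t).measure_preimage
    (psArc_measurable t s).nullMeasurableSet
  rw [← h1, Measure.restrict_apply
    ((AddCircle.measurePreserving_mk 1 t).measurable (psArc_measurable t s))]
  have hset : ((QuotientAddGroup.mk : ℝ → UnitAddCircle) ⁻¹' psArc t s) ∩ Set.Ioc t (t + 1)
      = Set.Ioo t s ∪ {t + 1} := by
    ext x
    constructor
    · rintro ⟨⟨y, hy, hyx⟩, hx⟩
      obtain ⟨z, hz⟩ := ps_coe_eq (x := x) (y := y) hyx.symm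
      have z1 : (-1 : ℝ) < z := by linarith [hy.2, hx.1]
      have z2 : (z : ℝ) ≤ 1 := by linarith [hy.1, hx.2]
      have z1' : -1 < z := by exact_mod_cast z1
      have z2' : z ≤ 1 := by exact_mod_cast z2
      have : z = 0 ∨ z = 1 := by omega
      rcases this with rfl | rfl
      · left
        simp at hz
        subst hz
        exact ⟨hx.1, hy.2⟩
      · right
        push_cast at hz
        simp only [Set.mem_singleton_iff]
        linarith [hy.1, hx.2]
    · rintro (hx | hx)
      · exact ⟨⟨x, ⟨hx.1.le, hx.2⟩, rfl⟩, hx.1, by linarith [hx.2]⟩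
      · simp only [Set.mem_singleton_iff] at hx
        subst hx
        refine ⟨⟨t, ⟨le_rfl, h⟩, ?_⟩, by linarith, le_rfl⟩
        have := ps_coe_add t 1
        push_cast at this
        exact this.symm
  rw [hset]
  refine le_antisymm ((measure_union_le _ _).trans ?_) ?_
  · simp
  · rw [← Real.volume_Ioo]
    exact measure_mono Set.subset_union_left

open MeasureTheory in
lemma ps_box_frontier {k : ℕ} (A : Fin k → Set UnitAddCircle)
    (hA : ∀ i, (AddCircle.haarAddCircle : Measure UnitAddCircle) (frontier (A i)) = 0) :
    psHaar k (frontier (Set.pi Set.univ A)) = 0 := by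
  have hsub : frontier (Set.pi Set.univ A) ⊆ ⋃ i, Function.eval i ⁻¹' frontier (A i) := by
    intro y hy
    rw [frontier, closure_pi_set, interior_pi_set Set.finite_univ] at hy
    obtain ⟨h1, h2⟩ := hy
    simp only [Set.mem_pi, Set.mem_univ, true_imp_iff, not_forall] at h1 h2
    obtain ⟨i, hi⟩ := h2
    exact Set.mem_iUnion.2 ⟨i, h1 i, hi⟩
  refine measure_mono_null hsub (measure_iUnion_null fun i => ?_)
  exact Measure.pi_eval_preimage_null _ (hA i)

lemma ps_mem_arc {m : ℤ} (hm : 1 ≤ m) {b : ℤ} (hb : 0 ≤ b ∧ b < m) (y : ℝ) :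
    ((y / m : ℝ) : UnitAddCircle) ∈ psArc (b / m) ((b + 1) / m) ↔ ⌊y⌋ % m = b := by
  have hm' : (0 : ℝ) < m := by exact_mod_cast (by omega : 0 < m)
  constructor
  · rintro ⟨r, hr, hry⟩
    obtain ⟨z, hz⟩ := ps_coe_eq hry.symm
    have h1 := (div_le_iff₀ hm').1 hr.1
    have h2 := (lt_div_iff₀ hm').1 hr.2
    have h3 : y = r * m + m * z := by
      field_simp at hz
      linarith
    have h4 : ⌊y⌋ = b + m * z := by
      rw [Int.floor_eq_iff]
      push_cast
      constructor <;> linarith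
    rw [h4, Int.add_mul_emod_self_left, Int.emod_eq_of_lt hb.1 hb.2]
  · intro h
    have h1 := Int.emod_add_mul_ediv ⌊y⌋ m
    rw [h] at h1
    have h2 : (⌊y⌋ : ℝ) = b + m * (⌊y⌋ / m : ℤ) := by exact_mod_cast h1.symm
    have h3 := Int.floor_le y
    have h4 := Int.lt_floor_add_one y
    set q : ℤ := ⌊y⌋ / m
    refine ⟨y / m - q, ⟨?_, ?_⟩, ?_⟩
    · rw [div_le_iff₀ hm', sub_mul, div_mul_cancel₀ _ hm'.ne']
      linarith
    · rw [lt_div_iff₀ hm', sub_mul, div_mul_cancel₀ _ hm'.ne']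
      linarith
    · have := ps_coe_add (y / m - q) q
      rw [sub_add_cancel] at this
      exact this.symm

theorem piatetski_shapiro_k_uniformly_distributed (c : ℝ) (hc : 1 < c)
    (hcint : ∀ n : ℤ, c ≠ (n : ℝ)) (m : ℤ) (hm : 1 ≤ m)
    (k : ℕ) (hk : 1 ≤ k) (hkc : (k : ℝ) ≤ c + 1)
    (B : Fin k → ℤ) (hB : ∀ i, 0 ≤ B i ∧ B i < m) :
    Tendsto (fun N : ℕ =>
        (Set.ncard {n : ℕ | n < N ∧ ∀ i : Fin k, ⌊((n + i : ℕ) : ℝ) ^ c⌋ % m = B i} : ℝ) / N)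
      atTop (nhds (1 / (m : ℝ) ^ k)) := by
  have hm' : (0 : ℝ) < m := by exact_mod_cast (by omega : 0 < m)
  have hm1 : (1 : ℝ) ≤ m := by exact_mod_cast hm
  set x : ℕ → (Fin k → UnitAddCircle) := fun n i =>
    (((((n + i : ℕ) : ℝ) ^ c) / m : ℝ) : UnitAddCircle) with hx
  set A : Fin k → Set UnitAddCircle := fun i => psArc (B i / m) ((B i + 1) / m) with hA
  have hlt : ∀ i, (B i / m : ℝ) < (B i + 1) / m := fun i => by gcongr; linarith
  have hle : ∀ i, ((B i + 1) / m : ℝ) ≤ B i / m + 1 := fun i => by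
    rw [add_div]
    gcongr
    rw [div_le_one hm']
    exact hm1
  have hexp : ∀ h : Fin k → ℤ, h ≠ 0 →
      Tendsto (psAvg (fun n => UnitAddTorus.mFourier h (x n))) atTop (nhds 0) := by
    intro h hh
    have key := ps_exp_sum (by linarith) hcint k hkc (fun i => 2 * Real.pi * h i / m) (by
      obtain ⟨i, hi⟩ := Function.ne_iff.1 hh
      refine Function.ne_iff.2 ⟨i, ?_⟩
      have : (h i : ℝ) ≠ 0 := by exact_mod_cast hi
      simp only [Pi.zero_apply]
      positivity)
    refine key.congr fun N => ?_
    congr 1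
    funext n
    have : UnitAddTorus.mFourier h (x n) = ∏ i, fourier (h i) (x n i) := rfl
    rw [this]
    simp only [hx, fourier_coe_apply]
    rw [← Complex.exp_sum]
    congr 1
    push_cast
    rw [Finset.mul_sum]
    refine Finset.sum_congr rfl fun i _ => ?_
    ring
  have main := ps_equidist x hexp (Set.pi Set.univ A)
    (ps_box_frontier A fun i => psArc_frontier (hlt i))
    (MeasurableSet.univ_pi fun i => psArc_measurable _ _)
  have hval : (psHaar k).real (Set.pi Set.univ A) = 1 / (m : ℝ) ^ k := by
    rw [MeasureTheory.measureReal_def, psHaar, MeasureTheory.Measure.pi_pi]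
    simp only [hA]
    rw [Finset.prod_congr rfl fun i _ => psArc_haar (hlt i) (hle i)]
    have : ∀ i : Fin k, ((B i + 1) / m - B i / m : ℝ) = 1 / m := fun i => by ring
    simp only [this, Finset.prod_const, Finset.card_univ, Fintype.card_fin, ENNReal.toReal_pow]
    rw [ENNReal.toReal_ofReal (by positivity), div_pow, one_pow]
  rw [hval] at main
  refine main.congr fun N => ?_
  congr 4
  ext n
  simp only [Set.mem_pi, Set.mem_univ, true_imp_iff, hx, hA]
  refine and_congr_right fun _ => forall_congr' fun i => ?_
  exact ps_mem_arc hm (hB i) _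
end

section
/- Let c with 1 < c < 2 and m ≥ 2 an integer. Then there exists a constant C₂ > 0 such that the subword complexity L_k of the sequence (⌊n^c⌋ mod m)_{n≥0} satisfies L_k ≥ C₂·k³ for all k ≥ 1. -/
/-- The subword complexity of the sequence `(⌊n^c⌋ mod m)ₙ`: the number of distinct
blocks of length `k` occurring as contiguous subwords. -/
noncomputable def psComplexity (c : ℝ) (m : ℤ) (k : ℕ) : ℕ :=
  Set.ncard {b : Fin k → ℤ | ∃ n : ℕ, ∀ i : Fin k, b i = ⌊((n + i : ℕ) : ℝ) ^ c⌋ % m}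

open Filter Topology in
lemma ps_diff_tendsto (c : ℝ) (hc1 : 1 < c) :
    Tendsto (fun n : ℕ => ((n + 1 : ℕ) : ℝ) ^ c - (n : ℝ) ^ c) atTop atTop := by
  have h0 : Tendsto (fun n : ℕ => c * (n : ℝ) ^ (c - 1)) atTop atTop :=
    ((tendsto_rpow_atTop (by linarith)).comp tendsto_natCast_atTop_atTop).const_mul_atTop
      (by linarith)
  refine tendsto_atTop_mono (fun n => ?_) h0
  obtain ⟨ξ, hξ, h⟩ := exists_hasDerivAt_eq_slope (fun x : ℝ => x ^ c)
    (fun x => c * x ^ (c - 1)) (show (n : ℝ) < n + 1 by linarith)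
    (fun x _ => (Real.hasDerivAt_rpow_const (Or.inr hc1.le)).continuousAt.continuousWithinAt)
    (fun x _ => Real.hasDerivAt_rpow_const (Or.inr hc1.le))
  have h1 : ((n + 1 : ℕ) : ℝ) ^ c - (n : ℝ) ^ c = c * ξ ^ (c - 1) := by
    rw [h]; push_cast; simp
  rw [h1]
  have := Real.rpow_le_rpow (Nat.cast_nonneg n) hξ.1.le (show 0 ≤ c - 1 by linarith)
  exact mul_le_mul_of_nonneg_left this (by linarith)

open Filter Topology in
lemma ps_diff2 (c : ℝ) (hc1 : 1 < c) (hc2 : c < 2) (ε : ℝ) (hε : 0 < ε) :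
    ∃ n₀ : ℕ, ∀ n : ℕ, n₀ ≤ n →
      |(((n + 2 : ℕ) : ℝ) ^ c - ((n + 1 : ℕ) : ℝ) ^ c)
        - (((n + 1 : ℕ) : ℝ) ^ c - (n : ℝ) ^ c)| ≤ ε := by
  have h0 : Tendsto (fun n : ℕ => c * ((c - 1) * (n : ℝ) ^ (-(2 - c)))) atTop (𝓝 (c * ((c-1) * 0))) :=
    (((tendsto_rpow_neg_atTop (by linarith : 0 < 2 - c)).comp
      tendsto_natCast_atTop_atTop).const_mul _).const_mul _
  simp only [mul_zero] at h0
  obtain ⟨N, hN⟩ := eventually_atTop.1 (h0.eventually (ge_mem_nhds hε))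
  refine ⟨N + 1, fun n hn => ?_⟩
  have hn0 : (0 : ℝ) < n := by exact_mod_cast (by omega : 0 < n)
  have hd : ∀ x : ℝ, HasDerivAt (fun x : ℝ => x ^ c) (c * x ^ (c - 1)) x :=
    fun x => Real.hasDerivAt_rpow_const (Or.inr hc1.le)
  have hD : ∀ x : ℝ, HasDerivAt (fun x : ℝ => (x + 1) ^ c - x ^ c)
      (c * (x + 1) ^ (c - 1) - c * x ^ (c - 1)) x := by
    intro x
    have := ((hd (x + 1)).comp x ((hasDerivAt_id x).add_const 1)).sub (hd x)
    simp only [id, mul_one] at this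
    exact this
  obtain ⟨ξ, hξ, h⟩ := exists_hasDerivAt_eq_slope _ _ (show (n : ℝ) < n + 1 by linarith)
    (fun x _ => (hD x).continuousAt.continuousWithinAt) (fun x _ => hD x)
  have hξ0 : 0 < ξ := hn0.trans hξ.1
  have hE : ∀ x ∈ Set.Ioo ξ (ξ + 1), HasDerivAt (fun x : ℝ => x ^ (c - 1))
      ((c - 1) * x ^ (c - 1 - 1)) x := fun x hx =>
    Real.hasDerivAt_rpow_const (Or.inl (by have := hx.1; linarith))
  obtain ⟨ζ, hζ, h'⟩ := exists_hasDerivAt_eq_slope (fun x : ℝ => x ^ (c - 1)) _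
    (show ξ < ξ + 1 by linarith)
    (fun x hx => (Real.continuousAt_rpow_const x (c-1) (Or.inr (by linarith))).continuousWithinAt) hE
  have e1 : (((n + 2 : ℕ) : ℝ) ^ c - ((n + 1 : ℕ) : ℝ) ^ c)
        - (((n + 1 : ℕ) : ℝ) ^ c - (n : ℝ) ^ c) = c * ((c - 1) * ζ ^ (-(2 - c))) := by
    have e2 : -(2 - c) = c - 1 - 1 := by ring
    rw [e2, h']
    have e3 : ((n + 2 : ℕ) : ℝ) = (n : ℝ) + 1 + 1 := by push_cast; ring
    rw [e3]
    push_cast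
    simp only [add_sub_cancel_left, div_one] at h ⊢
    linarith
  rw [e1, abs_of_nonneg (by have : 0 < ζ := hξ0.trans hζ.1
                            have := Real.rpow_pos_of_pos this (-(2-c))
                            have : 0 < c - 1 := by linarith
                            positivity)]
  refine le_trans ?_ (hN n (by omega))
  have h5 : ζ ^ (-(2 - c)) ≤ (n : ℝ) ^ (-(2 - c)) :=
    Real.rpow_le_rpow_of_nonpos hn0 (by linarith [hζ.1, hξ.1]) (by linarith)
  have h6 : 0 ≤ c - 1 := by linarith
  gcongr

/-- Starting points where the first difference is close to `β` mod `m`. -/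
lemma ps_start (f : ℕ → ℝ)
    (h1 : Filter.Tendsto (fun n : ℕ => f (n + 1) - f n) Filter.atTop Filter.atTop)
    (h2 : ∀ ε : ℝ, 0 < ε → ∃ n₀ : ℕ, ∀ n : ℕ, n₀ ≤ n →
      |(f (n + 2) - f (n + 1)) - (f (n + 1) - f n)| ≤ ε)
    (m : ℤ) (hm : 0 < m) (β ε : ℝ) (hε : 0 < ε) :
    ∃ (n : ℕ) (t : ℤ), |f (n + 1) - f n - (β + m * t)| ≤ ε ∧
      ∀ l : ℕ, |(f (n + l + 2) - f (n + l + 1)) - (f (n + l + 1) - f (n + l))| ≤ ε := by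
  obtain ⟨n₀, hn₀⟩ := h2 ε hε
  have hm' : (0 : ℝ) < m := by exact_mod_cast hm
  obtain ⟨t, ht⟩ : ∃ t : ℤ, f (n₀ + 1) - f n₀ < β + m * t := by
    obtain ⟨t, ht⟩ := exists_int_gt ((f (n₀ + 1) - f n₀ - β) / m)
    refine ⟨t, ?_⟩
    rw [div_lt_iff₀ hm'] at ht
    linarith
  have hex : ∃ j : ℕ, β + m * t ≤ f (n₀ + j + 1) - f (n₀ + j) := by
    obtain ⟨N, hN⟩ := Filter.eventually_atTop.1 (h1.eventually_ge_atTop (β + m * t))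
    exact ⟨N, hN (n₀ + N) (by omega)⟩
  classical
  have hs := Nat.find_spec hex
  obtain ⟨j, hj⟩ : ∃ j, Nat.find hex = j + 1 := by
    refine Nat.exists_eq_succ_of_ne_zero fun h0 => ?_
    rw [h0] at hs
    simp only [add_zero] at hs
    linarith
  have hmin := Nat.find_min hex (show j < Nat.find hex by omega)
  rw [hj] at hs
  push Not at hmin
  refine ⟨n₀ + (j + 1), t, ?_, fun l => hn₀ _ (by omega)⟩
  have h3 := abs_le.1 (hn₀ (n₀ + j) (by omega))
  have e : n₀ + (j + 1) = n₀ + j + 1 := by ring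
  rw [e] at hs ⊢
  rw [abs_le]
  constructor
  · linarith
  · have := h3.2
    have e' : n₀ + j + 2 = n₀ + j + 1 + 1 := by ring
    rw [e'] at this
    linarith

lemma ps_drift (f : ℕ → ℝ) (n : ℕ) (ε : ℝ) (b : ℝ)
    (h0 : |f (n + 1) - f n - b| ≤ ε)
    (h : ∀ l : ℕ, |(f (n + l + 2) - f (n + l + 1)) - (f (n + l + 1) - f (n + l))| ≤ ε) (l : ℕ) :
    |f (n + l) - f n - l * b| ≤ (l : ℝ) ^ 2 * ε := by
  have hε : 0 ≤ ε := (abs_nonneg _).trans h0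
  have hd : ∀ l : ℕ, |f (n + l + 1) - f (n + l) - b| ≤ (l + 1 : ℝ) * ε := by
    intro l
    induction l with
    | zero => simpa using h0
    | succ l ih =>
      have := abs_add_le (f (n + l + 1) - f (n + l) - b)
        ((f (n + l + 2) - f (n + l + 1)) - (f (n + l + 1) - f (n + l)))
      have e : f (n + (l + 1) + 1) - f (n + (l + 1)) - b = (f (n + l + 1) - f (n + l) - b) +
        ((f (n + l + 2) - f (n + l + 1)) - (f (n + l + 1) - f (n + l))) := by
        rw [show n + (l + 1) + 1 = n + l + 2 by ring, show n + (l + 1) = n + l + 1 by ring]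
        ring
      rw [e]
      push_cast
      linarith [h l]
  induction l with
  | zero => simp
  | succ l ih =>
    have := abs_add_le (f (n + l) - f n - l * b) (f (n + l + 1) - f (n + l) - b)
    have e : f (n + (l + 1)) - f n - ((l + 1 : ℕ) : ℝ) * b =
        (f (n + l) - f n - l * b) + (f (n + l + 1) - f (n + l) - b) := by
      rw [show n + (l + 1) = n + l + 1 by ring]; push_cast; ring
    rw [e]
    push_cast
    have := hd l
    have hl : (0 : ℝ) ≤ l := Nat.cast_nonneg l
    nlinarith [mul_nonneg hl hε]

/-- Multiples of `m P / R`, with `P` coprime to `R`, are `m / R`-dense mod `m`. -/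
lemma ps_dense (m : ℤ) (hm : 0 < m) (P : ℤ) (R : ℕ) (hR : 0 < R) (hPR : IsCoprime P (R : ℤ))
    (x : ℝ) : ∃ (j : ℕ) (s : ℤ), j < R ∧ |(j : ℝ) * (m * P / R) - (x + m * s)| ≤ m / R := by
  have hm' : (0 : ℝ) < m := by exact_mod_cast hm
  have hR' : (0 : ℝ) < R := by exact_mod_cast hR
  obtain ⟨u, v, huv⟩ := hPR
  set y : ℤ := ⌊x * R / m⌋ with hy
  have hRz : (0 : ℤ) < R := by exact_mod_cast hR
  have hjn := Int.emod_nonneg (u * y) hRz.ne'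
  have hjl := Int.emod_lt_of_pos (u * y) hRz
  obtain ⟨j, hj⟩ := Int.eq_ofNat_of_zero_le hjn
  -- j * P = y + R * s
  have hs : (j : ℤ) * P = y + R * (- v * y - P * (u * y / R)) := by
    have := Int.emod_add_mul_ediv (u * y) R
    have h2 : (j : ℤ) = u * y - R * (u * y / R) := by linarith
    rw [h2]
    linear_combination y * huv
  refine ⟨j, - v * y - P * (u * y / R), by omega, ?_⟩
  generalize (- v * y - P * (u * y / R)) = s at hs
  have hs' : (j : ℝ) * P = y + R * s := by exact_mod_cast hs
  have e : (j : ℝ) * (m * P / R) - (x + m * s) = (m / R) * (y - x * R / m) := by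
    have : (j : ℝ) * (m * P / R) = m * (j * P) / R := by ring
    rw [this, hs']
    field_simp
    ring
  rw [e, abs_mul, abs_of_pos (div_pos hm' hR')]
  have h1 := Int.floor_le (x * R / m)
  have h2 := Int.lt_floor_add_one (x * R / m)
  rw [← hy] at h1 h2
  have : |(y : ℝ) - x * R / m| ≤ 1 := by rw [abs_le]; constructor <;> linarith
  have h3 := div_pos hm' hR'
  nlinarith

lemma ps_approx (f : ℕ → ℝ)
    (h1 : Filter.Tendsto (fun n : ℕ => f (n + 1) - f n) Filter.atTop Filter.atTop)
    (h2 : ∀ ε : ℝ, 0 < ε → ∃ n₀ : ℕ, ∀ n : ℕ, n₀ ≤ n →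
      |(f (n + 2) - f (n + 1)) - (f (n + 1) - f n)| ≤ ε)
    (m : ℤ) (hm : 0 < m) (α β η : ℝ) (hη : 0 < η) (k : ℕ) :
    ∃ (n : ℕ) (s t : ℤ), ∀ i : ℕ, i < k → |f (n + i) - (α + i * β + m * (s + i * t))| < η := by
  have hm' : (0 : ℝ) < m := by exact_mod_cast hm
  obtain ⟨N, hN⟩ := exists_nat_gt (8 * m * (k + 1) / η)
  have hNpos : (0 : ℝ) < N := lt_of_le_of_lt (by positivity) hN
  have hN0 : 0 < N := by exact_mod_cast hNpos
  rw [div_lt_iff₀ hη] at hN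
  set v : ℤ := ⌊β * N / m⌋ with hv
  have hv1 := Int.floor_le (β * N / m)
  have hv2 := Int.lt_floor_add_one (β * N / m)
  rw [← hv] at hv1 hv2
  have hcop : IsCoprime (N * v + 1 : ℤ) ((N ^ 2 : ℕ) : ℤ) := by
    push_cast
    refine IsCoprime.pow_right ⟨1, -v, by ring⟩
  obtain ⟨β', hβ'⟩ : ∃ β' : ℝ, β' = m * ((N * v + 1 : ℤ) : ℝ) / ((N ^ 2 : ℕ) : ℝ) := ⟨_, rfl⟩
  have hN1 : (1 : ℝ) ≤ N := by exact_mod_cast hN0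
  have hββ : |β' - β| ≤ 2 * m / N := by
    have e : β' - β = (m / N) * (v - β * N / m + 1 / N) := by
      rw [hβ']; push_cast; field_simp; ring
    rw [e, abs_mul, abs_of_pos (div_pos hm' hNpos)]
    have : |v - β * N / m + 1 / N| ≤ 2 := by
      have : 1 / (N : ℝ) ≤ 1 := by rw [div_le_one hNpos]; exact hN1
      have : 0 < 1 / (N : ℝ) := by positivity
      rw [abs_le]; constructor <;> linarith
    calc (m / N : ℝ) * _ ≤ (m / N) * 2 := by gcongr
      _ = _ := by ring
  have hk4 : (k : ℝ) * (2 * m / N) ≤ η / 4 := by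
    rw [← mul_div_assoc, div_le_iff₀ hNpos]; nlinarith
  have hsp : (m : ℝ) / ((N ^ 2 : ℕ) : ℝ) ≤ η / 4 := by
    push_cast
    rw [div_le_iff₀ (by positivity)]
    have hk0 : (0 : ℝ) ≤ k := Nat.cast_nonneg k
    have : (m : ℝ) ≤ η / 4 * N := by nlinarith
    have : η / 4 * N ≤ η / 4 * N ^ 2 := by
      have : (N : ℝ) ≤ N ^ 2 := by nlinarith
      gcongr
    linarith
  obtain ⟨L, hL⟩ : ∃ L : ℕ, L = N ^ 2 + k + 1 := ⟨_, rfl⟩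
  have hLpos : (0 : ℝ) < L := by rw [hL]; positivity
  obtain ⟨n, t, ha, hb⟩ := ps_start f h1 h2 m hm β' (η / (4 * L ^ 2)) (by positivity)
  have hdr := ps_drift f n _ _ ha hb
  obtain ⟨j, s, hjR, hj⟩ := ps_dense m hm (N * v + 1) (N ^ 2) (by positivity) hcop (α - f n)
  rw [← hβ'] at hj
  refine ⟨n + j, s + j * t, t, fun i hi => ?_⟩
  have hl := hdr (j + i)
  have hl' : ((j + i : ℕ) : ℝ) ^ 2 * (η / (4 * L ^ 2)) ≤ η / 4 := by
    have : ((j + i : ℕ) : ℝ) ≤ L := by exact_mod_cast (by omega)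
    calc ((j + i : ℕ) : ℝ) ^ 2 * (η / (4 * L ^ 2)) ≤ (L : ℝ) ^ 2 * (η / (4 * L ^ 2)) := by gcongr
      _ = η / 4 := by field_simp
  have e : f (n + j + i) - (α + i * β + m * (((s + j * t : ℤ) : ℝ) + i * t)) =
      (f (n + (j + i)) - f n - ((j + i : ℕ) : ℝ) * (β' + m * t)) +
      ((j : ℝ) * β' - (α - f n + m * s)) + i * (β' - β) := by
    rw [add_assoc n j i]; push_cast; ring
  rw [e]
  have h3 : |(i : ℝ) * (β' - β)| ≤ η / 4 := by
    rw [abs_mul, abs_of_nonneg (Nat.cast_nonneg i)]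
    have : (i : ℝ) ≤ k := by exact_mod_cast hi.le
    refine le_trans ?_ hk4
    gcongr
  have := abs_add_three (f (n + (j + i)) - f n - ((j + i : ℕ) : ℝ) * (β' + m * t))
    ((j : ℝ) * β' - (α - f n + m * s)) (i * (β' - β))
  linarith

/-- Every discrete line word occurs. -/
lemma ps_occurs (c : ℝ) (hc1 : 1 < c) (hc2 : c < 2) (m : ℤ) (hm : 0 < m)
    (q p a k : ℕ) (hq : 0 < q) :
    ∃ n : ℕ, ∀ i : ℕ, i < k →
      ⌊((n + i : ℕ) : ℝ) ^ c⌋ % m = (((a + i * p) / q : ℕ) : ℤ) % m := by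
  have hq' : (0 : ℝ) < q := by exact_mod_cast hq
  obtain ⟨n, s, t, h⟩ := ps_approx (fun n => (n : ℝ) ^ c) (ps_diff_tendsto c hc1)
    (ps_diff2 c hc1 hc2) m hm ((a + 1 / 2) / q) (p / q) (1 / (2 * q)) (by positivity) k
  refine ⟨n, fun i hi => ?_⟩
  have h := abs_lt.1 (h i hi)
  have hdiv : ((q * ((a + i * p) / q) + (a + i * p) % q : ℕ) : ℝ) = (a + i * p : ℕ) := by
    rw [Nat.div_add_mod]
  have hmod : (((a + i * p) % q : ℕ) : ℝ) + 1 ≤ q := by exact_mod_cast Nat.mod_lt _ hq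
  have hmod0 : (0 : ℝ) ≤ (((a + i * p) % q : ℕ) : ℝ) := Nat.cast_nonneg _
  generalize (a + i * p) / q = u at *
  generalize (a + i * p) % q = r at *
  push_cast at hdiv
  have e : ((a : ℝ) + 1 / 2) / q + i * (p / q) = u + (r + 1 / 2) / q := by
    have : (a : ℝ) = q * u + r - i * p := by linarith
    rw [this]; field_simp; ring
  rw [e] at h
  have e1 : ((r : ℝ) + 1 / 2) / q - 1 / (2 * q) = r / q := by field_simp; ring
  have e2 : ((r : ℝ) + 1 / 2) / q + 1 / (2 * q) = (r + 1) / q := by field_simp; ring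
  have e3 : 0 ≤ (r : ℝ) / q := by positivity
  have e4 : ((r : ℝ) + 1) / q ≤ 1 := by rw [div_le_one hq']; exact hmod
  have : ⌊((n + i : ℕ) : ℝ) ^ c⌋ = (u : ℤ) + m * (s + i * t) := by
    rw [Int.floor_eq_iff]
    push_cast at h ⊢
    constructor <;> linarith [h.1, h.2]
  rw [this, Int.add_mul_emod_self_left]

/-- A coprime progression hits every residue in every window of length `q`. -/
lemma ps_hit (q p a : ℕ) (hq : 0 < q) (hpq : Nat.Coprime p q) (r : ℕ) (hr : r < q) (M : ℕ) :
    ∃ i, M ≤ i ∧ i < M + q ∧ (a + i * p) % q = r := by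
  have hqz : (0 : ℤ) < q := by exact_mod_cast hq
  obtain ⟨u, v, huv⟩ := Nat.isCoprime_iff_coprime.2 hpq
  have hn := Int.emod_nonneg (u * (r - a) - M) hqz.ne'
  have hl := Int.emod_lt_of_pos (u * (r - a) - M) hqz
  have hdm := Int.emod_add_mul_ediv (u * (r - a) - M) q
  obtain ⟨j, hj⟩ := Int.eq_ofNat_of_zero_le hn
  refine ⟨M + j, by omega, by omega, ?_⟩
  rw [hj] at hdm
  have : ((a + (M + j) * p : ℕ) : ℤ) =
      r + q * (- v * (r - a) - p * ((u * (r - a) - M) / q)) := by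
    push_cast
    linear_combination (r - a : ℤ) * huv + p * hdm
  have h2 : ((a + (M + j) * p : ℕ) : ℤ) % q = r := by
    rw [this, Int.add_mul_emod_self_left]
    exact Int.emod_eq_of_lt (by positivity) (by exact_mod_cast hr)
  exact_mod_cast h2

lemma ps_slope (Q q p a q' p' a' : ℕ) (hq : 0 < q) (hqQ : q ≤ Q) (hq' : 0 < q') (hqQ' : q' ≤ Q)
    (hpq : Nat.Coprime p q)
    (h : ∀ i, i < 3 * Q → (a + i * p) / q = (a' + i * p') / q') : p' * q ≤ p * q' := by
  by_contra hcon
  push Not at hcon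
  obtain ⟨i0, -, hi0, h0⟩ := ps_hit q p a hq hpq 0 hq 0
  obtain ⟨i1, hi1, hi1', h1⟩ := ps_hit q p a hq hpq (q - 1) (by omega) (2 * Q)
  have d0 := Nat.div_add_mod (a + i0 * p) q
  have d1 := Nat.div_add_mod (a + i1 * p) q
  have d0' := Nat.div_mul_le_self (a' + i0 * p') q'
  have d1' := Nat.lt_mul_div_succ (a' + i1 * p') hq'
  rw [h0, h i0 (by omega)] at d0
  rw [h1, h i1 (by omega)] at d1
  generalize (a' + i0 * p') / q' = x at *
  generalize (a' + i1 * p') / q' = y at *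
  obtain ⟨j, rfl⟩ : ∃ j, i1 = i0 + j := ⟨i1 - i0, by omega⟩
  have hj : q' ≤ j := by omega
  obtain ⟨r, rfl⟩ : ∃ r, q = r + 1 := ⟨q - 1, by omega⟩
  simp only [Nat.add_sub_cancel] at d1
  zify at *
  have k1 : (j : ℤ) * p' < q' * (y - x + 1) := by nlinarith
  have k2 : ((r : ℤ) + 1) * (y - x + 1) = j * p + 1 := by linear_combination d1 - d0
  have k3 : ((r : ℤ) + 1) * (j * p') < q' * (j * p + 1) := by
    rw [← k2]
    have : (0 : ℤ) < r + 1 := by positivity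
    nlinarith
  have k4 : (j : ℤ) * (p * q' + 1) ≤ j * (p' * (r + 1)) := by
    have : (0 : ℤ) ≤ j := by positivity
    apply mul_le_mul_of_nonneg_left _ this
    linarith
  nlinarith

lemma ps_offset (q p a a' k : ℕ) (hq : 0 < q) (hqk : q ≤ k) (hpq : Nat.Coprime p q)
    (h : ∀ i, i < k → (a + i * p) / q = (a' + i * p) / q) : a' ≤ a := by
  by_contra hcon
  push Not at hcon
  obtain ⟨i, -, hi, h1⟩ := ps_hit q p a hq hpq (q - 1) (by omega) 0
  have d := Nat.div_add_mod (a + i * p) q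
  have d' := Nat.lt_mul_div_succ (a' + i * p) hq
  rw [← h i (by omega)] at d'
  rw [h1] at d
  rw [mul_add] at d'
  omega

lemma ps_inj (Q q p a q' p' a' : ℕ) (hq : 0 < q) (hqQ : q ≤ Q) (hq' : 0 < q') (hqQ' : q' ≤ Q)
    (hpq : Nat.Coprime p q) (hpq' : Nat.Coprime p' q')
    (h : ∀ i, i < 3 * Q → (a + i * p) / q = (a' + i * p') / q') : q = q' ∧ p = p' ∧ a = a' := by
  have e : p' * q = p * q' := le_antisymm
    (ps_slope Q q p a q' p' a' hq hqQ hq' hqQ' hpq h)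
    (ps_slope Q q' p' a' q p a hq' hqQ' hq hqQ hpq' (fun i hi => (h i hi).symm))
  have eq : q = q' := by
    apply Nat.dvd_antisymm
    · exact hpq.symm.dvd_of_dvd_mul_left (Dvd.intro_left _ e)
    · exact hpq'.symm.dvd_of_dvd_mul_left (Dvd.intro_left _ e.symm)
  subst eq
  have ep : p = p' := (Nat.eq_of_mul_eq_mul_right hq e).symm
  subst ep
  exact ⟨rfl, rfl, le_antisymm
    (ps_offset q p a' a (3 * Q) hq (by omega) hpq fun i hi => (h i hi).symm)
    (ps_offset q p a a' (3 * Q) hq (by omega) hpq h)⟩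

lemma ps_step (q p a i : ℕ) (hpq : p ≤ q) :
    (a + (i + 1) * p) / q = (a + i * p) / q ∨ (a + (i + 1) * p) / q = (a + i * p) / q + 1 := by
  have h1 : (a + i * p) / q ≤ (a + (i + 1) * p) / q := Nat.div_le_div_right (by nlinarith)
  have h2 : (a + (i + 1) * p) / q ≤ (a + i * p) / q + 1 := by
    rcases Nat.eq_zero_or_pos q with h | h
    · simp [h]
    · rw [← Nat.add_div_right _ h]
      exact Nat.div_le_div_right (by nlinarith)
  omega

lemma ps_unmod (m : ℤ) (hm : 2 ≤ m) (k q p a q' p' a' : ℕ) (hpq : p ≤ q) (hpq' : p' ≤ q')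
    (ha : a < q) (ha' : a' < q')
    (h : ∀ i, i < k → (((a + i * p) / q : ℕ) : ℤ) % m = (((a' + i * p') / q' : ℕ) : ℤ) % m) :
    ∀ i, i < k → (a + i * p) / q = (a' + i * p') / q' := by
  intro i
  induction i with
  | zero => intro _; simp [Nat.div_eq_of_lt ha, Nat.div_eq_of_lt ha']
  | succ i ih =>
    intro hi
    have e := ih (by omega)
    have hh := Int.emod_eq_emod_iff_emod_sub_eq_zero.1 (h (i + 1) hi)
    have hh := Int.dvd_of_emod_eq_zero hh
    have key : ∀ z : ℤ, m ∣ z → |z| ≤ 1 → z = 0 := fun z h1 h2 =>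
      Int.eq_zero_of_abs_lt_dvd h1 (by linarith)
    have hz := key _ hh
    have h1 := ps_step q p a i hpq
    have h2 := ps_step q' p' a' i hpq'
    generalize (a + (i + 1) * p) / q = x at *
    generalize (a' + (i + 1) * p') / q' = y at *
    have := hz (by rw [abs_le]; omega)
    omega

lemma ps_totient (Q : ℕ) : (Q : ℝ) ^ 3 / 64 ≤ ((∑ q ∈ Finset.Ioc 0 Q, q * Nat.totient q : ℕ) : ℝ) := by
  rcases Nat.eq_zero_or_pos Q with h0 | hQ
  · simp [h0]
  have hQ' : (0 : ℝ) < Q := by exact_mod_cast hQ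
  have key : ∑ n ∈ Finset.Ioc 0 Q, n = ∑ d ∈ Finset.Ioc 0 Q, Nat.totient d * (Q / d) := by
    calc ∑ n ∈ Finset.Ioc 0 Q, n
        = ∑ n ∈ Finset.Ioc 0 Q, ∑ d ∈ Finset.Ioc 0 Q, if d ∣ n then Nat.totient d else 0 := by
          refine Finset.sum_congr rfl fun n hn => ?_
          rw [Finset.mem_Ioc] at hn
          conv_lhs => rw [← Nat.sum_totient n]
          rw [← Finset.sum_filter]
          refine Finset.sum_congr ?_ fun _ _ => rfl
          ext d
          simp only [Nat.mem_divisors, Finset.mem_filter, Finset.mem_Ioc]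
          constructor
          · rintro ⟨h1, h2⟩
            exact ⟨⟨Nat.pos_of_dvd_of_pos h1 hn.1, (Nat.le_of_dvd hn.1 h1).trans hn.2⟩, h1⟩
          · rintro ⟨-, h1⟩
            exact ⟨h1, by omega⟩
      _ = _ := by
          rw [Finset.sum_comm]
          refine Finset.sum_congr rfl fun d _ => ?_
          rw [← Finset.sum_filter, Finset.sum_const, Nat.Ioc_filter_dvd_card_eq_div,
            smul_eq_mul, mul_comm]
  have hsum : ∀ Q : ℕ, ((∑ n ∈ Finset.Ioc 0 Q, n : ℕ) : ℝ) = Q * (Q + 1) / 2 := by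
    intro Q
    induction Q with
    | zero => simp
    | succ Q ih =>
      rw [Finset.sum_Ioc_succ_top (by omega), Nat.cast_add, ih]; push_cast; ring
  have hpt : ∀ d ∈ Finset.Ioc 0 Q, ((Nat.totient d * (Q / d) : ℕ) : ℝ) ≤
      (if d ≤ Q / 4 then (Q : ℝ) else 0) + 16 / Q * ((d * Nat.totient d : ℕ) : ℝ) := by
    intro d hd
    rw [Finset.mem_Ioc] at hd
    split_ifs with h
    · have h1 : Nat.totient d * (Q / d) ≤ Q :=
        (Nat.mul_le_mul_right _ (Nat.totient_le d)).trans (Nat.mul_div_le Q d)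
      have h2 : ((Nat.totient d * (Q / d) : ℕ) : ℝ) ≤ Q := by exact_mod_cast h1
      have : 0 ≤ 16 / (Q : ℝ) * ((d * Nat.totient d : ℕ) : ℝ) := by positivity
      linarith
    · have h1 : (Q : ℝ) ≤ 4 * d := by exact_mod_cast (by omega : Q ≤ 4 * d)
      have hd0 : (0 : ℝ) < d := by exact_mod_cast hd.1
      have h2 : ((Q / d : ℕ) : ℝ) ≤ Q / d := Nat.cast_div_le
      have h3 : (Q : ℝ) / d ≤ 16 / Q * d := by
        rw [div_le_iff₀ hd0, div_mul_eq_mul_div, div_mul_eq_mul_div, le_div_iff₀ hQ']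
        nlinarith
      push_cast
      have h4 : (0 : ℝ) ≤ Nat.totient d := Nat.cast_nonneg _
      nlinarith [mul_le_mul_of_nonneg_left (h2.trans h3) h4]
  have hind : ∑ d ∈ Finset.Ioc 0 Q, (if d ≤ Q / 4 then (Q : ℝ) else 0) ≤ Q * Q / 4 := by
    rw [← Finset.sum_filter, Finset.sum_const, nsmul_eq_mul]
    have h1 : (Finset.filter (fun d => d ≤ Q / 4) (Finset.Ioc 0 Q)).card ≤ Q / 4 := by
      calc _ ≤ (Finset.Ioc 0 (Q / 4)).card := by
            apply Finset.card_le_card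
            intro d
            simp only [Finset.mem_filter, Finset.mem_Ioc]
            tauto
        _ = Q / 4 := by simp
    have h2 : ((Q / 4 : ℕ) : ℝ) ≤ Q / 4 := by simpa using (Nat.cast_div_le (α := ℝ) (m := Q) (n := 4))
    have h3 : ((Finset.filter (fun d => d ≤ Q / 4) (Finset.Ioc 0 Q)).card : ℝ) ≤ Q / 4 :=
      le_trans (by exact_mod_cast h1) h2
    nlinarith
  have hS := Finset.sum_le_sum hpt
  rw [Finset.sum_add_distrib, ← Finset.mul_sum, ← Nat.cast_sum, ← Nat.cast_sum, ← key, hsum] at hS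
  generalize ((∑ q ∈ Finset.Ioc 0 Q, q * Nat.totient q : ℕ) : ℝ) = S at *
  have : (Q : ℝ) * Q / 4 ≤ 16 / Q * S := by nlinarith
  rw [div_mul_eq_mul_div, le_div_iff₀ hQ'] at this
  linarith

theorem psComplexity_lower_bound (c : ℝ) (hc1 : 1 < c) (hc2 : c < 2)
    (m : ℤ) (hm : 2 ≤ m) :
    ∃ C₂ : ℝ, 0 < C₂ ∧ ∀ k : ℕ, 1 ≤ k →
      C₂ * (k : ℝ) ^ 3 ≤ (psComplexity c m k : ℝ) := by
  refine ⟨1 / 8000, by norm_num, fun k hk => ?_⟩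
  have hm0 : 0 < m := by omega
  have hfin : {b : Fin k → ℤ | ∃ n : ℕ, ∀ i : Fin k,
      b i = ⌊((n + i : ℕ) : ℝ) ^ c⌋ % m}.Finite := by
    refine (Set.Finite.pi (fun _ : Fin k => Set.finite_Ico (0 : ℤ) m)).subset ?_
    rintro b ⟨n, hn⟩ i -
    rw [hn i]
    exact ⟨Int.emod_nonneg _ hm0.ne', Int.emod_lt_of_pos _ hm0⟩
  set Q := k / 3 with hQ
  let T : Finset (Σ _ : ℕ, ℕ × ℕ) := (Finset.Ioc 0 Q).sigma fun q =>
    (Finset.range q) ×ˢ ((Finset.range q).filter (Nat.Coprime q))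
  have hTcard : T.card = ∑ q ∈ Finset.Ioc 0 Q, q * Nat.totient q := by
    rw [Finset.card_sigma]
    refine Finset.sum_congr rfl fun q _ => ?_
    rw [Finset.card_product, Finset.card_range, Nat.totient]
  let W : (Σ _ : ℕ, ℕ × ℕ) → (Fin k → ℤ) := fun x i =>
    (((x.2.1 + i * x.2.2) / x.1 : ℕ) : ℤ) % m
  have hinj : Set.InjOn W T := by
    rintro ⟨q, a, p⟩ hx ⟨q', a', p'⟩ hx' hW
    simp only [T, Finset.coe_sigma, Set.mem_sigma_iff, Finset.mem_coe, Finset.mem_Ioc,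
      Finset.mem_product, Finset.mem_filter, Finset.mem_range] at hx hx'
    obtain ⟨⟨h1, h2⟩, h3, h4, h5⟩ := hx
    obtain ⟨⟨h1', h2'⟩, h3', h4', h5'⟩ := hx'
    have hu := ps_unmod m hm k q p a q' p' a' h4.le h4'.le h3 h3'
      (fun i hi => congrFun hW ⟨i, hi⟩)
    obtain ⟨rfl, rfl, rfl⟩ := ps_inj Q q p a q' p' a' h1 h2 h1' h2' h5.symm h5'.symm
      (fun i hi => hu i (by omega))
    rfl
  have hcard : T.card ≤ psComplexity c m k := by
    rw [psComplexity, ← Finset.card_image_of_injOn hinj, ← Set.ncard_coe_finset]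
    refine Set.ncard_le_ncard ?_ hfin
    intro b hb
    rw [Finset.coe_image] at hb
    obtain ⟨⟨q, a, p⟩, hx, rfl⟩ := hb
    simp only [T, Finset.coe_sigma, Set.mem_sigma_iff, Finset.mem_coe, Finset.mem_Ioc] at hx
    obtain ⟨n, hn⟩ := ps_occurs c hc1 hc2 m hm0 q p a k hx.1.1
    exact ⟨n, fun i => (hn i i.2).symm⟩
  have hpos : 1 ≤ psComplexity c m k := by
    rw [psComplexity, Nat.one_le_iff_ne_zero, ← Nat.pos_iff_ne_zero, Set.ncard_pos hfin]
    exact ⟨fun i => ⌊((0 + i : ℕ) : ℝ) ^ c⌋ % m, 0, fun i => rfl⟩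
  have hpos' : (1 : ℝ) ≤ psComplexity c m k := by exact_mod_cast hpos
  rcases Nat.lt_or_ge k 3 with h | h
  · have hk2 : (k : ℝ) ≤ 2 := by exact_mod_cast (by omega : k ≤ 2)
    have : (k : ℝ) ^ 3 ≤ 2 ^ 3 := by gcongr
    linarith
  · have h5 : (k : ℝ) ≤ 5 * Q := by exact_mod_cast (by omega : k ≤ 5 * Q)
    have h6 : (k : ℝ) ^ 3 ≤ (5 * Q) ^ 3 := by gcongr
    have h7 := ps_totient Q
    rw [← hTcard] at h7
    have h8 : (T.card : ℝ) ≤ psComplexity c m k := by exact_mod_cast hcard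
    nlinarith
end

section
/- Let c with 1 < c < 2 and m ≥ 2 an integer, and let r > max{4/(2−c), 6}. Then there exists a constant C₁ such that the subword complexity L_k of (⌊n^c⌋ mod m)_{n≥0} satisfies L_k ≤ C₁·k^r for all k ≥ 1. In particular, the sequence is deterministic, i.e., (1/k)·log L_k → 0. -/
open Filter

/-- The set of lattice points below the graph of `f`. -/
noncomputable def psBelow (k J : ℕ) (f : ℝ → ℝ) : Finset (Fin k × Fin J) :=
  open Classical in
  Finset.univ.filter (fun p => ((p.2 : ℕ) : ℝ) + 1 ≤ f ((p.1 : ℕ) : ℝ))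

lemma psBelow_mem {k J : ℕ} {f : ℝ → ℝ} {p : Fin k × Fin J} :
    p ∈ psBelow k J f ↔ ((p.2 : ℕ) : ℝ) + 1 ≤ f ((p.1 : ℕ) : ℝ) := by
  simp [psBelow]

lemma ps_no_alt_convex {D : ℝ → ℝ} (hD : ConvexOn ℝ (Set.Ici 0) D) {x y z : ℝ}
    (hx : 0 ≤ x) (hxy : x < y) (hyz : y < z) (h1 : D x < 0) (h2 : 0 < D y) (h3 : D z < 0) :
    False := by
  have hmem : y ∈ segment ℝ x z := by
    rw [segment_eq_Icc (by linarith)]; exact ⟨hxy.le, hyz.le⟩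
  have := hD.le_on_segment (Set.mem_Ici.2 hx) (Set.mem_Ici.2 (by linarith)) hmem
  have h4 : max (D x) (D z) < 0 := max_lt h1 h3
  linarith

lemma ps_card (k J : ℕ) (h : ℕ → ℝ → ℝ)
    (hD : ∀ n n', ConvexOn ℝ (Set.Ici 0) (fun x => h n x - h n' x) ∨
      ConvexOn ℝ (Set.Ici 0) (fun x => h n' x - h n x))
    (𝒜 : Finset (Finset (Fin k × Fin J))) (h𝒜 : ∀ A ∈ 𝒜, ∃ n, A = psBelow k J (h n)) :
    𝒜.card ≤ ∑ i ∈ Finset.range 4, (k * J).choose i := by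
  classical
  have hvc : 𝒜.vcDim ≤ 3 := by
    unfold Finset.vcDim
    apply Finset.sup_le
    intro s hs
    rw [Finset.mem_shatterer] at hs
    by_contra hcard
    push Not at hcard
    obtain ⟨t, hts, htc⟩ := Finset.exists_subset_card_eq (n := 4) (s := s) (by omega)
    have ht := hs.mono_right hts
    have hinj : Set.InjOn (Prod.fst : Fin k × Fin J → Fin k) t := by
      have key : ∀ p ∈ t, ∀ q ∈ t, p.1 = q.1 → p.2 ≤ q.2 := by
        intro p hp q hq hpq
        by_contra hlt
        push Not at hlt
        obtain ⟨u, hu, htu⟩ := ht.exists_inter_eq_singleton hp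
        obtain ⟨n, rfl⟩ := h𝒜 u hu
        have hpu : p ∈ t ∩ psBelow k J (h n) := by rw [htu]; simp
        have hpu := psBelow_mem.1 (Finset.mem_inter.1 hpu).2
        have hqu : q ∈ t ∩ psBelow k J (h n) := by
          refine Finset.mem_inter.2 ⟨hq, psBelow_mem.2 ?_⟩
          rw [← hpq]
          have : ((q.2 : ℕ) : ℝ) < (p.2 : ℕ) := by exact_mod_cast hlt
          linarith
        rw [htu, Finset.mem_singleton] at hqu
        subst hqu
        exact lt_irrefl _ hlt
      intro p hp q hq hpq
      exact Prod.ext hpq (le_antisymm (key p hp q hq hpq) (key q hq p hp hpq.symm))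
    have hic : (t.image Prod.fst).card = 4 := by rw [Finset.card_image_of_injOn hinj, htc]
    let e := (t.image Prod.fst).orderEmbOfFin hic
    have he : ∀ l, ∃ p ∈ t, p.1 = e l := by
      intro l
      have := (t.image Prod.fst).orderEmbOfFin_mem hic l
      exact Finset.mem_image.1 this
    choose p hpt hpe using he
    have hlt : ∀ a b : Fin 4, a < b → ((p a).1 : ℕ) < ((p b).1 : ℕ) := by
      intro a b hab
      rw [hpe, hpe]
      exact (e.strictMono hab)
    have hpinj : ∀ a b : Fin 4, p a = p b → a = b := by
      intro a b hab
      apply e.injective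
      rw [← hpe, ← hpe, hab]
    have hmain : ∀ S : Finset (Fin 4), ∃ n, ∀ a, (p a ∈ psBelow k J (h n) ↔ a ∈ S) := by
      intro S
      obtain ⟨u, hu, htu⟩ := ht (t := S.image p) (by
        intro x hx
        obtain ⟨a, -, rfl⟩ := Finset.mem_image.1 hx
        exact hpt a)
      obtain ⟨n, rfl⟩ := h𝒜 u hu
      refine ⟨n, fun a => ?_⟩
      have h1 : p a ∈ t ∩ psBelow k J (h n) ↔ p a ∈ S.image p := by rw [htu]
      rw [Finset.mem_inter] at h1
      constructor
      · intro h2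
        obtain ⟨b, hb, hba⟩ := Finset.mem_image.1 (h1.1 ⟨hpt a, h2⟩)
        rwa [← hpinj _ _ hba]
      · intro h2
        exact (h1.2 (Finset.mem_image_of_mem p h2)).2
    obtain ⟨n, hn⟩ := hmain {0, 2}
    obtain ⟨n', hn'⟩ := hmain {1, 3}
    simp only [psBelow_mem] at hn hn'
    have a0 := (hn 0).2 (by decide)
    have a2 := (hn 2).2 (by decide)
    have a1 := (hn 1).not.2 (by decide)
    have a3 := (hn 3).not.2 (by decide)
    have b0 := (hn' 0).not.2 (by decide)
    have b2 := (hn' 2).not.2 (by decide)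
    have b1 := (hn' 1).2 (by decide)
    have b3 := (hn' 3).2 (by decide)
    push Not at a1 a3 b0 b2
    have l01 : (((p 0).1 : ℕ) : ℝ) < ((p 1).1 : ℕ) := by exact_mod_cast hlt 0 1 (by decide)
    have l12 : (((p 1).1 : ℕ) : ℝ) < ((p 2).1 : ℕ) := by exact_mod_cast hlt 1 2 (by decide)
    have l23 : (((p 2).1 : ℕ) : ℝ) < ((p 3).1 : ℕ) := by exact_mod_cast hlt 2 3 (by decide)
    rcases hD n n' with hc | hc
    · exact ps_no_alt_convex hc (Nat.cast_nonneg _) l12 l23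
        (by linarith) (by linarith) (by linarith)
    · exact ps_no_alt_convex hc (Nat.cast_nonneg _) l01 l12
        (by linarith) (by linarith) (by linarith)
  calc 𝒜.card ≤ 𝒜.shatterer.card := Finset.card_le_card_shatterer 𝒜
    _ ≤ ∑ i ∈ Finset.Iic 𝒜.vcDim, (Fintype.card (Fin k × Fin J)).choose i :=
        Finset.card_shatterer_le_sum_vcDim
    _ ≤ ∑ i ∈ Finset.range 4, (Fintype.card (Fin k × Fin J)).choose i := by
        apply Finset.sum_le_sum_of_subset
        intro i hi
        simp only [Finset.mem_Iic] at hi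
        simp only [Finset.mem_range]
        omega
    _ = _ := by simp

lemma ps_sum_choose (N : ℕ) (hN : 1 ≤ N) : ∑ i ∈ Finset.range 4, N.choose i ≤ 4 * N ^ 3 := by
  calc ∑ i ∈ Finset.range 4, N.choose i ≤ ∑ i ∈ Finset.range 4, N ^ 3 := by
        apply Finset.sum_le_sum
        intro i hi
        refine (Nat.choose_le_pow N i).trans (Nat.pow_le_pow_right hN ?_)
        simp only [Finset.mem_range] at hi
        omega
    _ = _ := by simp

/-- The normalised function. -/
noncomputable def psH (c : ℝ) (m : ℤ) (n : ℕ) (x : ℝ) : ℝ :=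
  ((n : ℝ) + x) ^ c - m * (⌊(n : ℝ) ^ c / m⌋ + ⌊c * (n : ℝ) ^ (c - 1) / m⌋ * x)

lemma psH_convex_aux (c : ℝ) (hc1 : 1 < c) (hc2 : c < 2) (m : ℤ) (n n' : ℕ) (hnn : n ≤ n') :
    ConvexOn ℝ (Set.Ici 0) (fun x => psH c m n x - psH c m n' x) := by
  have hder : ∀ (q : ℝ) (a : ℕ) (x : ℝ), 0 < x →
      HasDerivAt (fun x : ℝ => ((a : ℝ) + x) ^ q) (q * ((a : ℝ) + x) ^ (q - 1)) x := by
    intro q a x hx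
    have h1 : HasDerivAt (fun x : ℝ => (a : ℝ) + x) 1 x := (hasDerivAt_id x).const_add _
    have h2 := h1.rpow_const (p := q) (Or.inl (by positivity))
    convert h2 using 1
    ring
  have hlin : ∀ (u v x : ℝ), HasDerivAt (fun x : ℝ => (m : ℝ) * (u + v * x)) (m * v) x := by
    intro u v x
    have := (((hasDerivAt_id x).const_mul v).const_add u).const_mul (m : ℝ)
    simpa using this
  refine convexOn_of_hasDerivWithinAt2_nonneg (convex_Ici 0)
    (f' := fun x => (c * ((n : ℝ) + x) ^ (c - 1) - m * (⌊c * (n : ℝ) ^ (c - 1) / m⌋ : ℝ)) -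
      (c * ((n' : ℝ) + x) ^ (c - 1) - m * (⌊c * (n' : ℝ) ^ (c - 1) / m⌋ : ℝ)))
    (f'' := fun x => c * ((c - 1) * ((n : ℝ) + x) ^ (c - 1 - 1)) -
      c * ((c - 1) * ((n' : ℝ) + x) ^ (c - 1 - 1))) ?_ ?_ ?_ ?_
  · have hcont : ∀ a : ℕ, Continuous (psH c m a) := by
      intro a
      unfold psH
      refine Continuous.sub ?_ (by fun_prop)
      exact (continuous_const.add continuous_id).rpow_const (fun x => Or.inr (by linarith))
    exact ((hcont n).sub (hcont n')).continuousOn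
  · intro x hx
    rw [interior_Ici] at hx
    exact (((hder c n x hx).sub (hlin _ _ x)).sub
      ((hder c n' x hx).sub (hlin _ _ x))).hasDerivWithinAt
  · intro x hx
    rw [interior_Ici] at hx
    exact ((((hder (c - 1) n x hx).const_mul c).sub_const _).sub
      (((hder (c - 1) n' x hx).const_mul c).sub_const _)).hasDerivWithinAt
  · intro x hx
    rw [interior_Ici] at hx
    have hx : 0 < x := hx
    have hn : (n : ℝ) ≤ n' := by exact_mod_cast hnn
    have h1 : ((n' : ℝ) + x) ^ (c - 1 - 1) ≤ ((n : ℝ) + x) ^ (c - 1 - 1) :=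
      Real.rpow_le_rpow_of_nonpos (by positivity) (by linarith) (by linarith)
    have h2 : 0 ≤ c * (c - 1) := mul_nonneg (by linarith) (by linarith)
    have h3 := mul_le_mul_of_nonneg_left h1 h2
    linarith

lemma psH_bounds (c : ℝ) (hc1 : 1 < c) (hc2 : c < 2) (m : ℤ) (hm : 2 ≤ m) (k n i : ℕ)
    (hk : 1 ≤ k) (hik : i < k) (hn : (k : ℝ) ^ (2 / (2 - c)) ≤ n) :
    0 ≤ psH c m n i ∧ psH c m n i < m * k + 1 := by
  have hk0 : (1 : ℝ) ≤ k := by exact_mod_cast hk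
  have hkp : (0 : ℝ) < (k : ℝ) ^ (2 / (2 - c)) := by positivity
  have hn0 : (0 : ℝ) < n := lt_of_lt_of_le hkp hn
  have hm0 : (0 : ℝ) < m := by exact_mod_cast (by omega : (0 : ℤ) < m)
  have hs : (0 : ℝ) ≤ (i : ℝ) / n := by positivity
  have hi1 : (i : ℝ) + 1 ≤ k := by exact_mod_cast hik
  have hi0 : (0 : ℝ) ≤ i := Nat.cast_nonneg _
  have e0 : ((n : ℝ) + i) ^ c = (n : ℝ) ^ c * (1 + (i : ℝ) / n) ^ c := by
    rw [← Real.mul_rpow hn0.le (by positivity)]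
    congr 1
    field_simp
  have e1 : (n : ℝ) ^ c = (n : ℝ) ^ (c - 1) * n := by
    rw [Real.rpow_sub_one hn0.ne']; field_simp
  have e2 : (n : ℝ) ^ (c - 1) = (n : ℝ) ^ (c - 2) * n := by
    rw [show c - 2 = (c - 1) - 1 by ring, Real.rpow_sub_one hn0.ne' (c - 1)]; field_simp
  have hP : (0 : ℝ) < (n : ℝ) ^ c := by positivity
  have lo : (n : ℝ) ^ c + c * (n : ℝ) ^ (c - 1) * i ≤ ((n : ℝ) + i) ^ c := by
    have := one_add_mul_self_le_rpow_one_add (s := (i : ℝ) / n) (by linarith) hc1.le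
    have := mul_le_mul_of_nonneg_left this hP.le
    rw [e0]
    refine le_trans (le_of_eq ?_) this
    rw [e1]; field_simp
  have hsmall : (n : ℝ) ^ (c - 2) * (k : ℝ) ^ 2 ≤ 1 := by
    have h1 : (k : ℝ) ^ 2 ≤ (n : ℝ) ^ (2 - c) := by
      have := Real.rpow_le_rpow hkp.le hn (by linarith : 0 ≤ 2 - c)
      rw [← Real.rpow_mul (by linarith), div_mul_cancel₀ _ (by linarith : 2 - c ≠ 0)] at this
      exact_mod_cast this
    have h2 : (n : ℝ) ^ (c - 2) * (n : ℝ) ^ (2 - c) = 1 := by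
      rw [← Real.rpow_add hn0]; simp
    rw [← h2]
    gcongr
  have hi : ((n : ℝ) + i) ^ c ≤ (n : ℝ) ^ c + c * (n : ℝ) ^ (c - 1) * i + 1 := by
    have h1 := rpow_one_add_le_one_add_mul_self (s := (i : ℝ) / n) (p := c - 1) (by linarith)
      (by linarith) (by linarith)
    have h2 : (1 + (i : ℝ) / n) ^ c = (1 + (i : ℝ) / n) ^ (c - 1) * (1 + (i : ℝ) / n) := by
      rw [Real.rpow_sub_one (by positivity)]; field_simp
    have h3 : (1 + (i : ℝ) / n) ^ c ≤ (1 + (c - 1) * ((i : ℝ) / n)) * (1 + (i : ℝ) / n) := by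
      rw [h2]; gcongr
    have h4 := mul_le_mul_of_nonneg_left h3 hP.le
    rw [e0]
    refine h4.trans ?_
    have h5 : (n : ℝ) ^ c * ((1 + (c - 1) * ((i : ℝ) / n)) * (1 + (i : ℝ) / n)) =
        (n : ℝ) ^ c + c * (n : ℝ) ^ (c - 1) * i + (c - 1) * ((n : ℝ) ^ (c - 2) * (i : ℝ) ^ 2) := by
      rw [e1, e2]; field_simp; ring
    rw [h5]
    have h6 : (n : ℝ) ^ (c - 2) * (i : ℝ) ^ 2 ≤ 1 := by
      refine le_trans ?_ hsmall
      gcongr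
    have h7 : 0 ≤ (n : ℝ) ^ (c - 2) * (i : ℝ) ^ 2 := by positivity
    nlinarith
  have fl : ∀ y : ℝ, (m : ℝ) * ⌊y / m⌋ ≤ y ∧ y < m * ⌊y / m⌋ + m := by
    intro y
    have h1 := Int.floor_le (y / m)
    have h2 := Int.lt_floor_add_one (y / m)
    rw [le_div_iff₀ hm0] at h1
    rw [div_lt_iff₀ hm0] at h2
    constructor <;> linarith
  obtain ⟨u1, u2⟩ := fl ((n : ℝ) ^ c)
  obtain ⟨v1, v2⟩ := fl (c * (n : ℝ) ^ (c - 1))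
  have w1 := mul_le_mul_of_nonneg_right v1 hi0
  have w2 := mul_le_mul_of_nonneg_right v2.le hi0
  have w3 := mul_le_mul_of_nonneg_left hi1 hm0.le
  unfold psH
  constructor <;> linarith

lemma ps_word_eq (c : ℝ) (hc1 : 1 < c) (hc2 : c < 2) (m : ℤ) (hm : 2 ≤ m) (k n : ℕ)
    (hk : 1 ≤ k) (i : Fin k) (hn : (k : ℝ) ^ (2 / (2 - c)) ≤ n) :
    ⌊((n + i : ℕ) : ℝ) ^ c⌋ % m = (((Finset.univ.filter (fun j : Fin (m.toNat * k + 1) =>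
      (i, j) ∈ psBelow k (m.toNat * k + 1) (psH c m n))).card : ℕ) : ℤ) % m := by
  obtain ⟨h0, h1⟩ := psH_bounds c hc1 hc2 m hm k n i hk i.2 hn
  have hmt : ((m.toNat : ℕ) : ℝ) = m := by
    have : ((m.toNat : ℕ) : ℤ) = m := Int.toNat_of_nonneg (by omega)
    exact_mod_cast this
  have hfl : ⌊psH c m n i⌋₊ < m.toNat * k + 1 := by
    rw [Nat.floor_lt h0]
    push_cast
    rw [hmt]; exact h1
  have hcard : (Finset.univ.filter (fun j : Fin (m.toNat * k + 1) =>
      (i, j) ∈ psBelow k (m.toNat * k + 1) (psH c m n))).card = ⌊psH c m n i⌋₊ := by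
    have : (Finset.univ.filter (fun j : Fin (m.toNat * k + 1) =>
      (i, j) ∈ psBelow k (m.toNat * k + 1) (psH c m n))) =
        Finset.Iio (⟨⌊psH c m n i⌋₊, hfl⟩ : Fin (m.toNat * k + 1)) := by
      ext j
      simp only [Finset.mem_filter, Finset.mem_univ, true_and, psBelow_mem, Finset.mem_Iio,
        Fin.lt_def]
      rw [← Nat.succ_le_iff, Nat.le_floor_iff h0]
      push_cast
      rfl
    rw [this, Fin.card_Iio]
  rw [hcard, Int.natCast_floor_eq_floor h0]
  have : ((n + i : ℕ) : ℝ) ^ c = psH c m n i + ((m * (⌊(n : ℝ) ^ c / m⌋ +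
      ⌊c * (n : ℝ) ^ (c - 1) / m⌋ * (i : ℕ)) : ℤ) : ℝ) := by
    unfold psH; push_cast; ring
  rw [this, Int.floor_add_intCast, Int.add_mul_emod_self_left]

lemma ps_bound (c : ℝ) (hc1 : 1 < c) (hc2 : c < 2) (m : ℤ) (hm : 2 ≤ m) (k : ℕ) (hk : 1 ≤ k) :
    psComplexity c m k ≤ ⌈(k : ℝ) ^ (2 / (2 - c))⌉₊ + 4 * (k * (m.toNat * k + 1)) ^ 3 := by
  classical
  set N := ⌈(k : ℝ) ^ (2 / (2 - c))⌉₊ with hN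
  set J := m.toNat * k + 1 with hJ
  let w : ℕ → Fin k → ℤ := fun n i => ⌊((n + i : ℕ) : ℝ) ^ c⌋ % m
  let ψ : Finset (Fin k × Fin J) → Fin k → ℤ := fun A i =>
    (((Finset.univ.filter (fun j : Fin J => (i, j) ∈ A)).card : ℕ) : ℤ) % m
  let 𝒜 : Finset (Finset (Fin k × Fin J)) :=
    Finset.univ.filter (fun A => ∃ n, A = psBelow k J (psH c m n))
  have hsub : {b : Fin k → ℤ | ∃ n : ℕ, ∀ i : Fin k, b i = ⌊((n + i : ℕ) : ℝ) ^ c⌋ % m} ⊆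
      (((Finset.range N).image w ∪ 𝒜.image ψ : Finset (Fin k → ℤ)) : Set (Fin k → ℤ)) := by
    rintro b ⟨n, hb⟩
    have hbw : b = w n := funext hb
    rw [Finset.mem_coe, Finset.mem_union]
    by_cases hn : n < N
    · left
      exact Finset.mem_image.2 ⟨n, Finset.mem_range.2 hn, hbw.symm⟩
    · right
      refine Finset.mem_image.2 ⟨psBelow k J (psH c m n), ?_, ?_⟩
      · exact Finset.mem_filter.2 ⟨Finset.mem_univ _, n, rfl⟩
      · rw [hbw]
        funext i
        exact (ps_word_eq c hc1 hc2 m hm k n hk i (Nat.ceil_le.1 (not_lt.1 hn))).symm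
  have h𝒜 : 𝒜.card ≤ 4 * (k * J) ^ 3 := by
    refine (ps_card k J (psH c m) ?_ 𝒜 ?_).trans (ps_sum_choose _ ?_)
    · intro n n'
      rcases le_total n n' with h | h
      · exact Or.inl (psH_convex_aux c hc1 hc2 m n n' h)
      · exact Or.inr (psH_convex_aux c hc1 hc2 m n' n h)
    · intro A hA
      exact (Finset.mem_filter.1 hA).2
    · exact Nat.mul_pos hk (Nat.succ_pos _)
  unfold psComplexity
  calc _ ≤ Set.ncard (((Finset.range N).image w ∪ 𝒜.image ψ : Finset (Fin k → ℤ)) :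
        Set (Fin k → ℤ)) := Set.ncard_le_ncard hsub (Finset.finite_toSet _)
    _ = ((Finset.range N).image w ∪ 𝒜.image ψ).card := Set.ncard_coe_finset _
    _ ≤ ((Finset.range N).image w).card + (𝒜.image ψ).card := Finset.card_union_le _ _
    _ ≤ (Finset.range N).card + 𝒜.card := add_le_add Finset.card_image_le Finset.card_image_le
    _ ≤ _ := by rw [Finset.card_range]; exact Nat.add_le_add_left h𝒜 _

theorem psComplexity_upper_bound (c : ℝ) (hc1 : 1 < c) (hc2 : c < 2)
    (m : ℤ) (hm : 2 ≤ m) (r : ℝ) (hr : max (4 / (2 - c)) 6 < r) :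
    (∃ C₁ : ℝ, ∀ k : ℕ, 1 ≤ k → (psComplexity c m k : ℝ) ≤ C₁ * (k : ℝ) ^ r) ∧
    Tendsto (fun k : ℕ => Real.log (psComplexity c m k) / k) atTop (nhds 0) := by
  obtain ⟨hr1, hr2⟩ := max_lt_iff.1 hr
  set M : ℝ := (m.toNat : ℝ) with hM
  have hM0 : 0 ≤ M := Nat.cast_nonneg _
  have hbound : ∀ k : ℕ, 1 ≤ k →
      (psComplexity c m k : ℝ) ≤ (2 + 4 * (M + 1) ^ 3) * (k : ℝ) ^ r := by
    intro k hk
    have hk1 : (1 : ℝ) ≤ k := by exact_mod_cast hk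
    have h1 : (psComplexity c m k : ℝ) ≤
        (⌈(k : ℝ) ^ (2 / (2 - c))⌉₊ : ℝ) + 4 * (k * (M * k + 1)) ^ 3 := by
      rw [hM]
      exact_mod_cast ps_bound c hc1 hc2 m hm k hk
    have h2 : (⌈(k : ℝ) ^ (2 / (2 - c))⌉₊ : ℝ) < (k : ℝ) ^ (2 / (2 - c)) + 1 :=
      Nat.ceil_lt_add_one (by positivity)
    have h3 : (k : ℝ) ^ (2 / (2 - c)) ≤ (k : ℝ) ^ r := by
      apply Real.rpow_le_rpow_of_exponent_le hk1
      have : 2 / (2 - c) ≤ 4 / (2 - c) := by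
        apply div_le_div_of_nonneg_right (by norm_num) (by linarith)
      linarith
    have h4 : (1 : ℝ) ≤ (k : ℝ) ^ r := Real.one_le_rpow hk1 (by linarith)
    have h5 : (k : ℝ) ^ 6 ≤ (k : ℝ) ^ r := by
      rw [← Real.rpow_natCast]
      apply Real.rpow_le_rpow_of_exponent_le hk1
      push_cast; linarith
    have h6 : (k * (M * k + 1)) ^ 3 ≤ (M + 1) ^ 3 * (k : ℝ) ^ 6 := by
      have : (k : ℝ) * (M * k + 1) ≤ (M + 1) * (k : ℝ) ^ 2 := by nlinarith
      calc (k * (M * k + 1)) ^ 3 ≤ ((M + 1) * (k : ℝ) ^ 2) ^ 3 := by gcongr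
        _ = _ := by ring
    have h7 : (M + 1) ^ 3 * (k : ℝ) ^ 6 ≤ (M + 1) ^ 3 * (k : ℝ) ^ r := by gcongr
    linarith
  refine ⟨⟨_, hbound⟩, ?_⟩
  set C : ℝ := 2 + 4 * (M + 1) ^ 3 with hC
  have hC1 : 1 ≤ C := by
    have : 0 ≤ 4 * (M + 1) ^ 3 := by positivity
    linarith
  have hlim : Tendsto (fun k : ℕ => Real.log C / (k : ℝ) + r * (Real.log k / k)) atTop (nhds 0) := by
    have t1 : Tendsto (fun k : ℕ => Real.log C / (k : ℝ)) atTop (nhds 0) :=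
      tendsto_const_div_atTop_nhds_zero_nat _
    have t2 : Tendsto (fun k : ℕ => Real.log (k : ℝ) / (k : ℝ)) atTop (nhds 0) :=
      (Real.isLittleO_log_id_atTop.tendsto_div_nhds_zero).comp tendsto_natCast_atTop_atTop
    simpa using t1.add (t2.const_mul r)
  refine tendsto_of_tendsto_of_tendsto_of_le_of_le' tendsto_const_nhds hlim ?_ ?_
  · exact Eventually.of_forall fun k => div_nonneg (Real.log_natCast_nonneg _) (Nat.cast_nonneg _)
  · filter_upwards [eventually_ge_atTop 1] with k hk
    have hk1 : (1 : ℝ) ≤ k := by exact_mod_cast hk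
    have hk0 : (0 : ℝ) < k := by linarith
    have hlog : Real.log (psComplexity c m k) ≤ Real.log C + r * Real.log k := by
      rcases Nat.eq_zero_or_pos (psComplexity c m k) with h | h
      · rw [h]
        have := Real.log_nonneg hC1
        have := mul_nonneg (by linarith : 0 ≤ r) (Real.log_nonneg hk1)
        simp only [Nat.cast_zero, Real.log_zero]
        linarith
      · have := Real.log_le_log (by exact_mod_cast h) (hbound k hk)
        rwa [Real.log_mul (by linarith) (by positivity), Real.log_rpow hk0] at this
    calc _ ≤ (Real.log C + r * Real.log k) / k := by gcongr
      _ = _ := by ring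
end

section
/- Let c > 0 be a real number that is not an integer. Then there exists L > 0 such that for all pairs of distinct primes p, q > L, the real number (p/q)^c is irrational. -/
lemma six_rolle_finset {f f' : ℝ → ℝ} (hf : ∀ t, HasDerivAt f (f' t) t) {a b : ℝ} (n : ℕ)
    (Z : Finset ℝ) (hZ : ∀ z ∈ Z, z ∈ Set.Icc a b ∧ f z = 0) (hcard : n + 1 ≤ Z.card) :
    ∃ Z' : Finset ℝ, n ≤ Z'.card ∧ ∀ z ∈ Z', z ∈ Set.Icc a b ∧ f' z = 0 := by
  obtain ⟨Y, hYZ, hY⟩ := Finset.exists_subset_card_eq hcard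
  let e := Y.orderEmbOfFin hY
  have he : ∀ i, e i ∈ Z := fun i => hYZ (Finset.orderEmbOfFin_mem Y hY i)
  have hr : ∀ i : Fin n, ∃ z, e i.castSucc < z ∧ z < e i.succ ∧ f' z = 0 := by
    intro i
    have hlt : e i.castSucc < e i.succ := e.strictMono (Fin.castSucc_lt_succ)
    obtain ⟨z, hz, h0⟩ := exists_hasDerivAt_eq_zero hlt
      (fun t _ => (hf t).continuousAt.continuousWithinAt)
      ((hZ _ (he _)).2.trans (hZ _ (he _)).2.symm) (fun t _ => hf t)
    exact ⟨z, hz.1, hz.2, h0⟩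
  choose g h1 h2 h3 using hr
  have hg : StrictMono g := by
    intro i j hij
    refine (h2 i).trans_le (le_trans ?_ (h1 j).le)
    apply e.monotone
    rw [Fin.le_def]
    simpa using hij
  refine ⟨Finset.univ.image g, ?_, ?_⟩
  · rw [Finset.card_image_of_injective _ hg.injective]; simp
  · intro z hz
    obtain ⟨i, -, rfl⟩ := Finset.mem_image.1 hz
    exact ⟨⟨(hZ _ (he _)).1.1.trans (h1 i).le, (h2 i).le.trans (hZ _ (he _)).1.2⟩, h3 i⟩

lemma six_rolle_iter (f : ℕ → ℝ → ℝ) (hf : ∀ k t, HasDerivAt (f k) (f (k + 1) t) t)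
    {a b : ℝ} (n : ℕ) (k : ℕ)
    (Z : Finset ℝ) (hZ : ∀ z ∈ Z, z ∈ Set.Icc a b ∧ f k z = 0) (hcard : n + 1 ≤ Z.card) :
    ∃ z ∈ Set.Icc a b, f (k + n) z = 0 := by
  induction n generalizing k Z with
  | zero =>
    obtain ⟨z, hz⟩ := Finset.card_pos.1 hcard
    exact ⟨z, (hZ z hz).1, (hZ z hz).2⟩
  | succ n ih =>
    obtain ⟨Z', hc, hZ'⟩ := six_rolle_finset (hf k) (n + 1) Z hZ hcard
    obtain ⟨z, hz, h⟩ := ih (k + 1) Z' hZ' hc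
    exact ⟨z, hz, by rw [← h]; congr 1; omega⟩

lemma six_expoly_zero {ι : Type*} [DecidableEq ι] (s : Finset ι) (a w : ι → ℝ)
    (hw : Set.InjOn w s) (Z : Finset ℝ) (hcard : s.card ≤ Z.card)
    (hZ : ∀ z ∈ Z, ∑ i ∈ s, a i * Real.exp (w i * z) = 0) : ∀ i ∈ s, a i = 0 := by
  induction s using Finset.induction_on generalizing a w Z with
  | empty => simp
  | insert i0 s hi ih =>
    rw [Finset.card_insert_of_notMem hi] at hcard
    have hne : Z.Nonempty := Finset.card_pos.1 (by omega)
    let f : ℝ → ℝ := fun t => a i0 + ∑ i ∈ s, a i * Real.exp ((w i - w i0) * t)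
    let f' : ℝ → ℝ := fun t => ∑ i ∈ s, (a i * (w i - w i0)) * Real.exp ((w i - w i0) * t)
    have hf : ∀ t, HasDerivAt f (f' t) t := by
      intro t
      refine HasDerivAt.const_add _ (HasDerivAt.fun_sum fun i _ => ?_)
      have := (((hasDerivAt_id' t).const_mul (w i - w i0)).exp).const_mul (a i)
      exact this.congr_deriv (by ring)
    have hfz : ∀ z ∈ Z, f z = 0 := by
      intro z hz
      have h := hZ z hz
      rw [Finset.sum_insert hi] at h
      have : f z = Real.exp (-(w i0 * z)) *
          (a i0 * Real.exp (w i0 * z) + ∑ i ∈ s, a i * Real.exp (w i * z)) := by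
        simp only [f, mul_add, Finset.mul_sum]
        congr 1
        · rw [mul_left_comm, ← Real.exp_add]; simp
        · refine Finset.sum_congr rfl fun i _ => ?_
          rw [mul_left_comm, ← Real.exp_add]; ring_nf
      rw [this, h, mul_zero]
    obtain ⟨Z', hc, hZ'⟩ := six_rolle_finset hf (a := Z.min' hne) (b := Z.max' hne) s.card Z
      (fun z hz => ⟨⟨Z.min'_le z hz, Z.le_max' z hz⟩, hfz z hz⟩) hcard
    have h0 : ∀ i ∈ s, a i = 0 := by
      have := ih (fun i => a i * (w i - w i0)) (fun i => w i - w i0) ?_ Z' hc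
        (fun z hz => (hZ' z hz).2)
      · intro i his
        rcases mul_eq_zero.1 (this i his) with h | h
        · exact h
        · have : i = i0 := hw (by simp [his]) (by simp) (sub_eq_zero.1 h)
          exact absurd (this ▸ his) hi
      · intro i his j hjs hij
        exact hw (by simp [Finset.mem_coe.1 his]) (by simp [Finset.mem_coe.1 hjs])
          (by simpa using hij)
    intro i his
    rcases Finset.mem_insert.1 his with rfl | h
    · obtain ⟨z, hz⟩ := hne
      have := hfz z hz
      simp only [f] at this
      rw [Finset.sum_eq_zero (fun j hj => by rw [h0 j hj, zero_mul]), add_zero] at this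
      exact this
    · exact h0 i h

lemma six_interp {β : Type*} [Fintype β] (a w : β → ℝ) (A W R : ℝ) (hA : ∀ i, |a i| ≤ A)
    (hW : ∀ i, |w i| ≤ W) (hW0 : 0 ≤ W) (hA0 : 0 ≤ A) (M : ℕ) (Z : Finset ℝ) (hM : Z.card = M)
    (hZ : ∀ z ∈ Z, |z| ≤ R ∧ ∑ i, a i * Real.exp (w i * z) = 0) (y : ℝ) (hy : |y| ≤ R) :
    |∑ i, a i * Real.exp (w i * y)| ≤
      (Fintype.card β * (A * W ^ M * Real.exp (W * R))) * (2 * R) ^ M / M.factorial := by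
  have hR0 : 0 ≤ R := (abs_nonneg y).trans hy
  by_cases hyZ : y ∈ Z
  · rw [(hZ y hyZ).2, abs_zero]; positivity
  let P : Polynomial ℝ := ∏ z ∈ Z, (Polynomial.X - Polynomial.C z)
  have hPm : P.Monic := Polynomial.monic_prod_of_monic _ _ fun z _ => Polynomial.monic_X_sub_C z
  have hPd : P.natDegree = M := by
    rw [← hM]; exact Polynomial.natDegree_finsetProd_X_sub_C_eq_card (s := Z) (f := id) 
  have hPe : ∀ t, P.eval t = ∏ z ∈ Z, (t - z) := by
    intro t; simp [P, Polynomial.eval_prod]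
  have hPy : P.eval y ≠ 0 := by
    rw [hPe, Finset.prod_ne_zero_iff]
    intro z hz h
    exact hyZ (by rwa [sub_eq_zero.1 h])
  set Fy := ∑ i, a i * Real.exp (w i * y) with hFy
  let f : ℕ → ℝ → ℝ := fun k t => (∑ i, (a i * w i ^ k) * Real.exp (w i * t)) -
    Fy / P.eval y * (Polynomial.derivative^[k] P).eval t
  have hf : ∀ k t, HasDerivAt (f k) (f (k + 1) t) t := by
    intro k t
    refine HasDerivAt.fun_sub (HasDerivAt.fun_sum fun i _ => ?_) (HasDerivAt.const_mul _ ?_)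
    · have := (((hasDerivAt_id' t).const_mul (w i)).exp).const_mul (a i * w i ^ k)
      exact this.congr_deriv (by ring)
    · rw [Function.iterate_succ_apply']
      exact Polynomial.hasDerivAt _ _
  obtain ⟨ξ, hξ, h0⟩ := six_rolle_iter f hf (a := -R) (b := R) M 0 (insert y Z) (by
    intro z hz
    rcases Finset.mem_insert.1 hz with rfl | hz
    · refine ⟨abs_le.1 hy, ?_⟩
      simp only [f, pow_zero, mul_one, Function.iterate_zero, id]
      rw [div_mul_cancel₀ _ hPy, ← hFy, sub_self]
    · refine ⟨abs_le.1 (hZ z hz).1, ?_⟩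
      simp only [f, pow_zero, mul_one, Function.iterate_zero, id]
      rw [(hZ z hz).2, hPe z, Finset.prod_eq_zero hz (sub_self z)]; simp) (by
    rw [Finset.card_insert_of_notMem hyZ, hM])
  have hder : (Polynomial.derivative^[M] P).eval ξ = M.factorial := by
    have := Polynomial.iterate_derivative_eq_factorial_smul_sum P M
    have h2 := Polynomial.natDegree_iterate_derivative P M
    rw [hPd, Nat.sub_self] at h2
    rw [Polynomial.eq_C_of_natDegree_le_zero h2, Polynomial.eval_C,
      Polynomial.coeff_iterate_derivative]
    simp [Nat.descFactorial_self]
    have := hPm.coeff_natDegree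
    rw [hPd] at this
    simp [this]
  simp only [f, zero_add, hder] at h0
  have hM0 : (0 : ℝ) < M.factorial := by positivity
  have hFeq : Fy = (∑ i, (a i * w i ^ M) * Real.exp (w i * ξ)) * P.eval y / M.factorial := by
    rw [sub_eq_zero.1 h0]; field_simp
  have hb1 : |∑ i, (a i * w i ^ M) * Real.exp (w i * ξ)| ≤
      Fintype.card β * (A * W ^ M * Real.exp (W * R)) := by
    refine (Finset.abs_sum_le_sum_abs _ _).trans ?_
    rw [← nsmul_eq_mul, ← Finset.card_univ]
    refine Finset.sum_le_card_nsmul _ _ _ fun i _ => ?_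
    rw [abs_mul, abs_mul, abs_pow, Real.abs_exp]
    have : w i * ξ ≤ W * R := by
      refine (le_abs_self _).trans ?_
      rw [abs_mul]
      exact mul_le_mul (hW i) (abs_le.2 hξ) (abs_nonneg _) hW0
    gcongr
    · exact hA i
    · exact hW i
  have hb2 : |P.eval y| ≤ (2 * R) ^ M := by
    rw [hPe, Finset.abs_prod, ← hM]
    rw [← Finset.prod_const]
    refine Finset.prod_le_prod (fun _ _ => abs_nonneg _) fun z hz => ?_
    have := abs_sub y z
    have := (hZ z hz).1
    linarith
  rw [hFeq, abs_div, abs_mul, abs_of_pos hM0]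
  gcongr

attribute [local instance] Matrix.seminormedAddCommGroup

lemma six_siegel {α β : Type*} [Fintype α] [Fintype β] (A : Matrix α β ℤ) (C : ℕ) (hC : 1 ≤ C)
    (hA : ∀ i j, |A i j| ≤ C) (hm : 0 < Fintype.card α)
    (hn : 2 * Fintype.card α ≤ Fintype.card β) :
    ∃ t : β → ℤ, t ≠ 0 ∧ (∀ i, ∑ j, A i j * t j = 0) ∧
      ∀ j, |(t j : ℝ)| ≤ Fintype.card β * C := by
  obtain ⟨t, h0, h1, h2⟩ := Int.Matrix.exists_ne_zero_int_vec_norm_le A (by omega) hm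
  have hC' : (1 : ℝ) ≤ C := by exact_mod_cast hC
  have hAn : max 1 ‖A‖ ≤ C := by
    refine max_le hC' ((Matrix.norm_le_iff (by positivity)).2 fun i j => ?_)
    rw [Int.norm_eq_abs]
    exact_mod_cast hA i j
  have hn1 : (1 : ℝ) ≤ Fintype.card β := by exact_mod_cast (by omega : 1 ≤ Fintype.card β)
  refine ⟨t, h0, fun i => congrFun h1 i, fun j => ?_⟩
  have h3 : |(t j : ℝ)| ≤ ‖t‖ := by
    rw [← Int.norm_eq_abs]; exact norm_le_pi_norm t j
  refine h3.trans (h2.trans ?_)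
  have hm' : (0 : ℝ) < Fintype.card α := by exact_mod_cast hm
  have hn' : 2 * (Fintype.card α : ℝ) ≤ Fintype.card β := by exact_mod_cast hn
  calc _ ≤ ((Fintype.card β : ℝ) * max 1 ‖A‖) ^ (1 : ℝ) := by
        refine Real.rpow_le_rpow_of_exponent_le ?_ ?_
        · nlinarith [le_max_left (1 : ℝ) ‖A‖]
        · rw [div_le_one (by linarith)]; linarith
    _ ≤ _ := by rw [Real.rpow_one]; gcongr

/-- the final numerical estimate -/
lemma six_numeric (B c X : ℝ) (hB : 1 ≤ B) (hc : 0 < c) (hX : 0 ≤ X) :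
    ∃ T : ℕ, 0 < T ∧ B ^ (32 * T ^ 3) *
      (((4 * T ^ 4 : ℕ) * (((4 * T ^ 4 : ℕ) * B ^ (16 * T ^ 3)) * (2 * T ^ 2 * (1 + c)) ^ (T ^ 4) *
        Real.exp ((2 * T ^ 2 * (1 + c)) * (2 * T * X)))) * (2 * (2 * T * X)) ^ (T ^ 4) /
          (T ^ 4).factorial) < 1 := by
  set K : ℝ := 2 ^ 12 * B ^ 48 * Real.exp (4 * (1 + c) * X) with hK
  set C : ℝ := 8 * Real.exp 1 * (1 + c) * X with hCdef
  obtain ⟨T, hT⟩ := exists_nat_ge (K + 2 * C + 1)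
  have hK0 : 0 < K := by positivity
  have hC0 : 0 ≤ C := by positivity
  have hT0 : (0 : ℝ) < T := by linarith
  have hTn : 0 < T := by exact_mod_cast hT0
  refine ⟨T, hTn, ?_⟩
  have hfac : ((T : ℝ) ^ 4) ^ (T ^ 4) / (T ^ 4).factorial ≤ Real.exp 1 ^ (T ^ 4) := by
    have := Real.pow_div_factorial_le_exp (x := (T : ℝ) ^ 4) (by positivity) (T ^ 4)
    rw [← Real.exp_nat_mul]
    simpa using this
  have hfac2 : 1 / ((T ^ 4).factorial : ℝ) ≤ (Real.exp 1 / T ^ 4) ^ (T ^ 4) := by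
    rw [div_pow, le_div_iff₀ (by positivity)]
    calc _ = ((T : ℝ) ^ 4) ^ (T ^ 4) / (T ^ 4).factorial := by ring
      _ ≤ _ := hfac
  have hmain : (2 * T ^ 2 * (1 + c)) ^ (T ^ 4) * (2 * (2 * T * X)) ^ (T ^ 4) *
      (1 / ((T ^ 4).factorial : ℝ)) ≤ (1 / 2) ^ (T ^ 4) := by
    calc _ ≤ (2 * T ^ 2 * (1 + c)) ^ (T ^ 4) * (2 * (2 * T * X)) ^ (T ^ 4) *
          (Real.exp 1 / T ^ 4) ^ (T ^ 4) := by gcongr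
      _ = (C / T) ^ (T ^ 4) := by
        rw [← mul_pow, ← mul_pow]; congr 1; rw [hCdef]; field_simp; ring
      _ ≤ _ := by
        refine pow_le_pow_left₀ (by positivity) ?_ _
        rw [div_le_div_iff₀ hT0 (by norm_num)]; linarith
  have hT2 : (T : ℝ) ≤ 2 ^ T := by exact_mod_cast Nat.lt_two_pow_self.le
  have hTT : T ≤ T ^ 3 := Nat.le_self_pow (by norm_num) T
  have h16 : (16 : ℝ) * T ^ 8 ≤ (2 ^ 12) ^ (T ^ 3) := by
    calc (16 : ℝ) * T ^ 8 ≤ 16 * (2 ^ T) ^ 8 := by gcongr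
      _ = 2 ^ (4 + 8 * T) := by rw [pow_add, ← pow_mul]; ring
      _ ≤ 2 ^ (12 * T ^ 3) := by gcongr <;> [norm_num; omega]
      _ = _ := by rw [pow_mul]
  have hKT : K < 2 ^ T := by linarith
  calc _ = (16 * T ^ 8) * (B ^ 48) ^ (T ^ 3) * Real.exp (4 * (1 + c) * X) ^ (T ^ 3) *
      ((2 * T ^ 2 * (1 + c)) ^ (T ^ 4) * (2 * (2 * T * X)) ^ (T ^ 4) *
      (1 / ((T ^ 4).factorial : ℝ))) := by
        have e1 : (B ^ 48) ^ (T ^ 3) = B ^ (32 * T ^ 3) * B ^ (16 * T ^ 3) := by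
          rw [← pow_mul, ← pow_add]; congr 1; ring
        have e2 : Real.exp ((2 * T ^ 2 * (1 + c)) * (2 * T * X)) =
            Real.exp (4 * (1 + c) * X) ^ (T ^ 3) := by
          rw [← Real.exp_nat_mul]; congr 1; push_cast; ring
        rw [e1, e2]; push_cast; ring
    _ ≤ ((2 ^ 12) ^ (T ^ 3)) * (B ^ 48) ^ (T ^ 3) * Real.exp (4 * (1 + c) * X) ^ (T ^ 3) *
        (1 / 2) ^ (T ^ 4) := by gcongr
    _ = K ^ (T ^ 3) * (1 / 2) ^ (T ^ 4) := by rw [hK, mul_pow, mul_pow]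
    _ < (2 ^ T) ^ (T ^ 3) * (1 / 2) ^ (T ^ 4) := by
        have : T ^ 3 ≠ 0 := by positivity
        gcongr
    _ = 1 := by
        rw [← pow_mul, ← pow_succ', ← mul_pow]; norm_num

lemma six_rat_case (c : ℝ) (hc : 0 < c) (hcint : ∀ n : ℤ, c ≠ (n : ℝ)) (hrat : ¬ Irrational c)
    (p q : ℕ) (hp : p.Prime) (hq : q.Prime) (hpq : p ≠ q) : Irrational (((p : ℝ) / q) ^ c) := by
  rintro ⟨s, hs⟩
  obtain ⟨r, rfl⟩ := not_not.1 hrat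
  have hr0 : 0 < r := by exact_mod_cast hc
  have hp0 : (0 : ℝ) < p := by exact_mod_cast hp.pos
  have hq0 : (0 : ℝ) < q := by exact_mod_cast hq.pos
  have hs0 : (0 : ℝ) < s := by rw [hs]; positivity
  have hsne : s ≠ 0 := by rintro rfl; simp at hs0
  have h1 : (s : ℝ) ^ r.den = ((p : ℝ) / q) ^ r.num := by
    rw [hs, ← Real.rpow_mul_natCast (by positivity), ← Real.rpow_intCast]
    congr 1
    exact_mod_cast Rat.mul_den_eq_num r
  have h2 : s ^ r.den = ((p : ℚ) / q) ^ r.num := by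
    apply Rat.cast_injective (α := ℝ)
    push_cast
    exact h1
  have := Fact.mk hp
  have := Fact.mk hq
  have hpQ : (p : ℚ) ≠ 0 := by exact_mod_cast hp.ne_zero
  have hqQ : (q : ℚ) ≠ 0 := by exact_mod_cast hq.ne_zero
  have h3 := congrArg (padicValRat p) h2
  rw [padicValRat.pow, padicValRat.zpow,
    padicValRat.div hpQ hqQ, padicValRat.self hp.one_lt, padicValRat.of_nat,
    padicValNat_primes hpq] at h3
  simp at h3
  apply hcint (padicValRat p s)
  have : r = padicValRat p s := by
    have h4 := Rat.num_div_den r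
    rw [← h4, ← h3]
    have : (r.den : ℚ) ≠ 0 := by exact_mod_cast r.den_ne_zero
    push_cast
    field_simp
  exact_mod_cast this

lemma six_core (c : ℝ) (hc : 0 < c) (hirr : Irrational c) (p q s t : Fin 4 → ℕ)
    (hp : ∀ j, 0 < p j) (hq : ∀ j, 0 < q j) (hs : ∀ j, 0 < s j) (ht : ∀ j, 0 < t j)
    (hst : ∀ j, (s j : ℝ) / t j = ((p j : ℝ) / q j) ^ c)
    (hinj : Function.Injective
      fun k : Fin 4 → ℕ => ∑ j, (k j : ℝ) * Real.log ((p j : ℝ) / q j)) : False := by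
  set x : Fin 4 → ℝ := fun j => Real.log ((p j : ℝ) / q j) with hx
  set X : ℝ := ∑ j, |x j| with hX
  have hX0 : 0 ≤ X := Finset.sum_nonneg fun _ _ => abs_nonneg _
  let B : ℕ := ∑ j, (p j + q j + s j + t j)
  have hle : ∀ j, p j + q j + s j + t j ≤ B := fun j =>
    Finset.single_le_sum (f := fun j => p j + q j + s j + t j) (fun _ _ => Nat.zero_le _)
      (Finset.mem_univ j)
  have hB1 : 1 ≤ B := by have := hle 0; have := hp 0; omega
  have hpB : ∀ j, p j ≤ B := fun j => by have := hle j; omega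
  have hqB : ∀ j, q j ≤ B := fun j => by have := hle j; omega
  have hsB : ∀ j, s j ≤ B := fun j => by have := hle j; omega
  have htB : ∀ j, t j ≤ B := fun j => by have := hle j; omega
  obtain ⟨T, hT, hnum⟩ := six_numeric B c X (by exact_mod_cast hB1) hc hX0
  set S : ℕ := 2 * T ^ 2 with hS
  let E : (Fin 4 → ℕ) → Fin S × Fin S → ℕ := fun k ab =>
    ∏ j, (p j ^ (ab.1 * k j : ℕ) * q j ^ ((S - ab.1) * k j) * s j ^ (ab.2 * k j : ℕ) *
      t j ^ ((S - ab.2) * k j))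
  let D : (Fin 4 → ℕ) → ℕ := fun k => ∏ j, (q j * t j) ^ (S * k j)
  let z : (Fin 4 → ℕ) → ℝ := fun k => ∑ j, (k j : ℝ) * x j
  let w : Fin S × Fin S → ℝ := fun ab => (ab.1 : ℕ) + (ab.2 : ℕ) * c
  have hexp : ∀ j, Real.exp (x j) = (p j : ℝ) / q j := fun j => by
    have := hp j; have := hq j
    exact Real.exp_log (by positivity)
  have hexpc : ∀ j, Real.exp (c * x j) = (s j : ℝ) / t j := fun j => by
    have := hp j; have := hq j
    rw [hst, Real.rpow_def_of_pos (by positivity), mul_comm]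
  have hED : ∀ k ab, (E k ab : ℝ) = D k * Real.exp (w ab * z k) := by
    intro k ab
    simp only [E, D, w, z, Finset.mul_sum, Real.exp_sum]
    push_cast
    rw [← Finset.prod_mul_distrib]
    refine Finset.prod_congr rfl fun j _ => ?_
    have e : ((ab.1 : ℕ) + (ab.2 : ℕ) * c) * (k j * x j) =
      ((ab.1 * k j : ℕ) : ℝ) * x j + ((ab.2 * k j : ℕ) : ℝ) * (c * x j) := by push_cast; ring
    rw [e, Real.exp_add, Real.exp_nat_mul, Real.exp_nat_mul, hexp, hexpc]
    have h1 : S * k j = ab.1 * k j + (S - ab.1) * k j := by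
      rw [← add_mul]; congr 1; have := ab.1.2; omega
    have h2 : S * k j = ab.2 * k j + (S - ab.2) * k j := by
      rw [← add_mul]; congr 1; have := ab.2.2; omega
    have hq' : (q j : ℝ) ≠ 0 := by exact_mod_cast (hq j).ne'
    have ht' : (t j : ℝ) ≠ 0 := by exact_mod_cast (ht j).ne'
    rw [mul_pow, div_pow, div_pow]
    nth_rewrite 1 [h1]
    rw [h2, pow_add, pow_add]
    field_simp
  have hEB : ∀ (K : ℕ) k ab, (∀ j, k j ≤ K) → E k ab ≤ B ^ (8 * S * K) := by
    intro K k ab hk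
    calc E k ab ≤ ∏ j : Fin 4, B ^ (2 * S * K) := by
          refine Finset.prod_le_prod' fun j _ => ?_
          calc _ ≤ B ^ (ab.1 * k j : ℕ) * B ^ ((S - ab.1) * k j) * B ^ (ab.2 * k j : ℕ) *
                  B ^ ((S - ab.2) * k j) := by
                gcongr
                exacts [hpB j, hqB j, hsB j, htB j]
            _ = B ^ (2 * S * k j) := by
                rw [← pow_add, ← pow_add, ← pow_add, ← add_mul, ← add_mul, ← add_mul]
                congr 2
                have := ab.1.2; have := ab.2.2; omega
            _ ≤ _ := by
                have := hk j
                gcongr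
      _ = _ := by
        rw [Finset.prod_const, ← pow_mul]; congr 1; simp; ring
  have hDB : ∀ (K : ℕ) k, (∀ j, k j ≤ K) → D k ≤ B ^ (8 * S * K) := by
    intro K k hk
    calc D k ≤ ∏ j : Fin 4, (B * B) ^ (S * K) := by
          refine Finset.prod_le_prod' fun j _ => ?_
          calc _ ≤ (B * B) ^ (S * k j) := by
                gcongr
                exacts [hqB j, htB j]
            _ ≤ _ := by
                have := hk j
                gcongr
                nlinarith
      _ = _ := by
        rw [Finset.prod_const, ← pow_two, ← pow_mul, ← pow_mul]; congr 1; simp; ring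
  have hD0 : ∀ k, 0 < D k := fun k => Finset.prod_pos fun j _ => by
    have := hq j; have := ht j; positivity
  have hzR : ∀ k : Fin 4 → ℕ, (∀ j, k j ≤ 2 * T) → |z k| ≤ 2 * T * X := by
    intro k hk
    refine (Finset.abs_sum_le_sum_abs _ _).trans ?_
    rw [hX, Finset.mul_sum]
    refine Finset.sum_le_sum fun j _ => ?_
    rw [abs_mul, Nat.abs_cast]
    gcongr
    exact_mod_cast hk j
  have hwW : ∀ ab, |w ab| ≤ 2 * T ^ 2 * (1 + c) := by
    intro ab
    have h1 : ((ab.1 : ℕ) : ℝ) ≤ 2 * T ^ 2 := by exact_mod_cast ab.1.2.le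
    have h2 : ((ab.2 : ℕ) : ℝ) ≤ 2 * T ^ 2 := by exact_mod_cast ab.2.2.le
    rw [abs_of_nonneg (by positivity)]
    simp only [w]
    nlinarith
  have hwinj : Function.Injective w := by
    rintro ⟨a, b⟩ ⟨a', b'⟩ h
    simp only [w] at h
    have hb : (b : ℕ) = b' := by
      by_contra hne
      have hne' : (((b : ℕ) : ℝ) - (b' : ℕ)) ≠ 0 := by
        rw [sub_ne_zero]; exact_mod_cast hne
      refine hirr ⟨(((a' : ℕ) : ℚ) - (a : ℕ)) / (((b : ℕ) : ℚ) - (b' : ℕ)), ?_⟩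
      push_cast
      rw [div_eq_iff hne']
      linarith
    have ha : (a : ℕ) = a' := by
      rw [hb] at h
      exact_mod_cast add_right_cancel h
    rw [Prod.mk.injEq]
    exact ⟨Fin.ext ha, Fin.ext hb⟩
  have hcardβ : Fintype.card (Fin S × Fin S) = 4 * T ^ 4 := by
    simp [hS]; ring
  let A : Matrix (Fin 4 → Fin T) (Fin S × Fin S) ℤ := fun k ab => E (fun j => k j) ab
  obtain ⟨v, hv0, hv1, hv2⟩ := six_siegel A (B ^ (16 * T ^ 3)) (Nat.one_le_pow _ _ hB1)
    (by
      intro k ab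
      have := hEB T (fun j => k j) ab (fun j => (k j).2.le)
      simp only [A, Nat.abs_cast]
      refine Int.ofNat_le.2 (this.trans (le_of_eq ?_))
      congr 1; rw [hS]; ring)
    (by simp; positivity) (by rw [hcardβ]; simp; omega)
  let F : ℝ → ℝ := fun y => ∑ ab, (v ab : ℝ) * Real.exp (w ab * y)
  have hDF : ∀ k, (D k : ℝ) * F (z k) = ((∑ ab, (E k ab : ℤ) * v ab : ℤ) : ℝ) := by
    intro k
    push_cast
    simp only [F, Finset.mul_sum]
    refine Finset.sum_congr rfl fun ab _ => ?_
    rw [hED]; ring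
  let Z : Finset ℝ := Finset.univ.image fun k : Fin 4 → Fin T => z fun j => k j
  have hcast : ∀ n : ℕ, Function.Injective fun k : Fin 4 → Fin n => z fun j => k j := by
    intro n k l hkl
    have := hinj hkl
    funext j
    exact Fin.ext (congrFun this j)
  have hZc : Z.card = T ^ 4 := by
    rw [Finset.card_image_of_injective _ (hcast T)]; simp
  have hZ : ∀ y ∈ Z, |y| ≤ 2 * T * X ∧ ∑ ab, (v ab : ℝ) * Real.exp (w ab * y) = 0 := by
    intro y hy
    obtain ⟨k, -, rfl⟩ := Finset.mem_image.1 hy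
    refine ⟨hzR _ fun j => by have := (k j).2; omega, ?_⟩
    have h := hDF fun j => k j
    have h' := hv1 k
    simp only [A] at h'
    rw [h'] at h
    have hD := hD0 fun j => k j
    rcases mul_eq_zero.1 (h.trans Int.cast_zero) with h | h
    · exact absurd h (by exact_mod_cast hD.ne')
    · exact h
  have hvan : ∀ k : Fin 4 → Fin (2 * T), F (z fun j => k j) = 0 := by
    intro k
    have hk : ∀ j, ((k j : ℕ)) ≤ 2 * T := fun j => (k j).2.le
    have hb := six_interp (fun ab => (v ab : ℝ)) w _ _ (2 * T * X) hv2 hwW (by positivity)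
      (by positivity) (T ^ 4) Z hZc hZ (z fun j => k j) (hzR _ hk)
    rw [hcardβ] at hb
    have hDk : ((D fun j => k j : ℕ) : ℝ) ≤ (B : ℝ) ^ (32 * T ^ 3) := by
      have := hDB (2 * T) (fun j => k j) hk
      have e : 8 * S * (2 * T) = 32 * T ^ 3 := by rw [hS]; ring
      rw [e] at this
      exact_mod_cast this
    have hlt : |((D fun j => k j : ℕ) : ℝ) * F (z fun j => k j)| < 1 := by
      rw [abs_mul, Nat.abs_cast]
      refine lt_of_le_of_lt (mul_le_mul hDk hb (abs_nonneg _) (by positivity)) ?_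
      push_cast at hnum ⊢
      exact hnum
    rw [hDF] at hlt
    have hz : (∑ ab, (E (fun j => k j) ab : ℤ) * v ab : ℤ) = 0 := by
      rw [← Int.abs_lt_one_iff]
      exact_mod_cast hlt
    have h := hDF fun j => k j
    rw [hz] at h
    have hD := hD0 fun j => k j
    rcases mul_eq_zero.1 (h.trans Int.cast_zero) with h | h
    · exact absurd h (by exact_mod_cast hD.ne')
    · exact h
  apply hv0
  funext ab
  have := six_expoly_zero Finset.univ (fun ab => (v ab : ℝ)) w hwinj.injOn
    (Finset.univ.image fun k : Fin 4 → Fin (2 * T) => z fun j => k j) (by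
      rw [Finset.card_image_of_injective _ (hcast (2 * T)), Finset.card_univ, hcardβ]
      simp
      rw [mul_pow]; omega) (by
      intro y hy
      obtain ⟨k, -, rfl⟩ := Finset.mem_image.1 hy
      exact hvan k) ab (Finset.mem_univ _)
  exact_mod_cast this

lemma six_padic_prod (r : ℕ) [Fact r.Prime] (f : Fin 4 → ℚ) (hf : ∀ j, f j ≠ 0) :
    padicValRat r (∏ j, f j) = ∑ j, padicValRat r (f j) := by
  rw [Fin.prod_univ_four, Fin.sum_univ_four, padicValRat.mul, padicValRat.mul, padicValRat.mul]
  all_goals simp [hf]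

lemma six_indep (p q : Fin 4 → ℕ) (hp : ∀ j, (p j).Prime) (hq : ∀ j, (q j).Prime)
    (hpp : Function.Injective p) (hpq : ∀ i j, p i ≠ q j) :
    Function.Injective
      fun k : Fin 4 → ℕ => ∑ j, (k j : ℝ) * Real.log ((p j : ℝ) / q j) := by
  have hpos : ∀ j, (0 : ℝ) < (p j : ℝ) / q j := fun j => by
    have := (hp j).pos; have := (hq j).pos; positivity
  intro k l hkl
  have h1 : ∏ j, ((p j : ℝ) / q j) ^ k j = ∏ j, ((p j : ℝ) / q j) ^ l j := by
    have := congrArg Real.exp hkl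
    simp only [Real.exp_sum, Real.exp_nat_mul] at this
    simpa only [Real.exp_log (hpos _)] using this
  have h2 : ∏ j, ((p j : ℚ) / q j) ^ k j = ∏ j, ((p j : ℚ) / q j) ^ l j := by
    apply Rat.cast_injective (α := ℝ)
    push_cast
    exact h1
  have hpQ : ∀ j, (p j : ℚ) ≠ 0 := fun j => by exact_mod_cast (hp j).ne_zero
  have hqQ : ∀ j, (q j : ℚ) ≠ 0 := fun j => by exact_mod_cast (hq j).ne_zero
  funext i
  have := Fact.mk (hp i)
  have hval : ∀ j, padicValRat (p i) ((p j : ℚ) / q j) = if j = i then 1 else 0 := by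
    intro j
    have := Fact.mk (hp j)
    have := Fact.mk (hq j)
    rw [padicValRat.div (hpQ j) (hqQ j), padicValRat.of_nat, padicValRat.of_nat,
      padicValNat_primes (hpq i j)]
    split_ifs with h
    · subst h; simp
    · rw [padicValNat_primes (fun e => h (hpp e).symm)]; simp
  have h3 : ∀ k : Fin 4 → ℕ, padicValRat (p i) (∏ j, ((p j : ℚ) / q j) ^ k j) = k i := by
    intro k
    rw [six_padic_prod _ _ (fun j => pow_ne_zero _ (div_ne_zero (hpQ j) (hqQ j)))]
    simp [padicValRat.pow, hval]
  have h4 := congrArg (padicValRat (p i)) h2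
  rw [h3, h3] at h4
  exact_mod_cast h4

theorem ratio_of_large_primes_rpow_irrational (c : ℝ) (hc : 0 < c)
    (hcint : ∀ n : ℤ, c ≠ (n : ℝ)) :
    ∃ L : ℕ, ∀ p q : ℕ, p.Prime → q.Prime → p ≠ q → L < p → L < q →
      Irrational (((p : ℝ) / q) ^ c) := by
  by_cases hirr : Irrational c
  swap
  · exact ⟨0, fun p q hp hq hpq _ _ => six_rat_case c hc hcint hirr p q hp hq hpq⟩
  by_contra! hcon
  choose P Q hP hQ hPQ hLP hLQ hrat using hcon
  -- a sequence of thresholds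
  let L : ℕ → ℕ := fun n => Nat.rec 0 (fun _ m => P m + Q m) n
  have hL : ∀ n, L (n + 1) = P (L n) + Q (L n) := fun n => rfl
  have hLm : StrictMono L := strictMono_nat_of_lt_succ fun n => by
    rw [hL]; have := hLP (L n); omega
  have hlt : ∀ m n, m < n → P (L m) < P (L n) ∧ P (L m) < Q (L n) ∧ Q (L m) < P (L n) := by
    intro m n hmn
    have h1 : L (m + 1) ≤ L n := hLm.monotone hmn
    have h2 := hLP (L n)
    have h3 := hLQ (L n)
    rw [hL] at h1
    omega
  let p : Fin 4 → ℕ := fun j => P (L j)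
  let q : Fin 4 → ℕ := fun j => Q (L j)
  have hratio : ∀ j, ∃ s t : ℕ, 0 < s ∧ 0 < t ∧ (s : ℝ) / t = ((p j : ℝ) / q j) ^ c := by
    intro j
    obtain ⟨r, hr⟩ := not_not.1 (hrat (L j))
    have hp0 : (0 : ℝ) < p j := by exact_mod_cast (hP (L j)).pos
    have hq0 : (0 : ℝ) < q j := by exact_mod_cast (hQ (L j)).pos
    have hr' : (r : ℝ) = ((p j : ℝ) / q j) ^ c := hr
    have hr0 : (0 : ℝ) < r := by rw [hr']; positivity
    have hr1 : 0 < r := by exact_mod_cast hr0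
    have hnum : 0 < r.num := Rat.num_pos.2 hr1
    refine ⟨r.num.toNat, r.den, by omega, r.den_pos, ?_⟩
    rw [← hr', Rat.cast_def]
    congr 1
    have : ((r.num.toNat : ℤ) : ℝ) = (r.num : ℝ) := by rw [Int.toNat_of_nonneg hnum.le]
    exact_mod_cast this
  choose s t hs ht hst using hratio
  refine six_core c hc hirr p q s t (fun j => (hP _).pos) (fun j => (hQ _).pos) hs ht hst
    (six_indep p q (fun j => hP _) (fun j => hQ _) ?_ ?_)
  · intro i j hij
    by_contra hne
    simp only [p] at hij
    rcases lt_or_gt_of_ne (fun h => hne (Fin.ext h) : (i : ℕ) ≠ j) with h | h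
    · have := hlt _ _ h; omega
    · have := hlt _ _ h; omega
  · intro i j hij
    simp only [p, q] at hij
    rcases lt_trichotomy (i : ℕ) j with h | h | h
    · have := hlt _ _ h; omega
    · rw [h] at hij; exact hPQ _ hij
    · have := hlt _ _ h; omega
end
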